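/- arXiv:1608.02468 — 2 statements merged into one kernel-verified Lean document; each statement's English description precedes it below -/
import Mathlib

section
/- For all integers k ≤ p, the submeasure ν_{k,p} has the covering property. -/
open Ordinal Filter
open scoped ENNReal
/-- `A ≤ₛ B`: same cardinality and the increasing enumeration of `A` is pointwise `≤`
that of `B`. -/
def SpreadLE (A B : Finset ℕ) : Prop :=
  List.Forall₂ (· ≤ ·) (A.sort (· ≤ ·)) (B.sort (· ≤ ·))
open Classical in
/-- The finite initial segment `A ∩ [0,n)` of a set `A ⊆ ℕ`. -/
noncomputable def initSeg (A : Set ℕ) (n : ℕ) : Finset ℕ :=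
  (Finset.range n).filter (· ∈ A)

/-- An admissible norm on finite subsets of `ℕ`: vanishing on `∅`, equal to `1` on
singletons, monotone, subadditive, unbounded along every infinite set, and spreading. -/
structure IsAdmissibleNorm (nrm : Finset ℕ → ℕ) : Prop where
  empty : nrm ∅ = 0
  singleton : ∀ n : ℕ, nrm {n} = 1
  mono : ∀ A B : Finset ℕ, A ⊆ B → nrm A ≤ nrm B
  subadd : ∀ A B : Finset ℕ, nrm (A ∪ B) ≤ nrm A + nrm B
  unbounded : ∀ A : Set ℕ, A.Infinite →
    Filter.Tendsto (fun n => nrm (initSeg A n)) Filter.atTop Filter.atTop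
  spreading : ∀ A B : Finset ℕ, SpreadLE A B → nrm A ≤ nrm B
/-- The space `T = ∏ₙ 2ⁿ`. -/
abbrev TT : Type := (n : ℕ) → Fin (2 ^ n)

/-- The atom of rank `m` (basic cylinder) determined by the first `m` coordinates of `x`;
the atoms of `ℬ_m` are exactly the sets `cylSet m x`. -/
def cylSet (m : ℕ) (x : TT) : Set TT := {y | ∀ i < m, y i = x i}

/-- Membership in `ℬ_n`: the set depends only on coordinates `< n`. -/
def memB (n : ℕ) (X : Set TT) : Prop :=
  ∀ x y : TT, (∀ i < n, x i = y i) → (x ∈ X ↔ y ∈ X)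

/-- `X` does not depend on coordinates `< m`. -/
def indepBelow (m : ℕ) (X : Set TT) : Prop :=
  ∀ x y : TT, (∀ i, m ≤ i → x i = y i) → (x ∈ X ↔ y ∈ X)

/-- The retraction `π_A : T → A` for the atom `A = cylSet m x`. -/
def piMap (m : ℕ) (x : TT) (z : TT) : TT := fun i => if i < m then x i else z i

/-- `[X]_n`: the smallest member of `ℬ_n` containing `X`. -/
def clsn (n : ℕ) (X : Set TT) : Set TT := {y | ∃ x ∈ X, ∀ i < n, y i = x i}

/-- `int_n(X)`: the largest member of `ℬ_n` contained in `X`. -/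
def intn (n : ℕ) (X : Set TT) : Set TT := {y | cylSet n y ⊆ X}

/-- A submeasure on the algebra `ℬ` of clopen subsets of `T`. -/
structure IsSubmeasureOn (ν : Set TT → ℝ≥0∞) : Prop where
  empty : ν ∅ = 0
  mono : ∀ X Y : Set TT, IsClopen X → IsClopen Y → X ⊆ Y → ν X ≤ ν Y
  subadd : ∀ X Y : Set TT, IsClopen X → IsClopen Y → ν (X ∪ Y) ≤ ν X + ν Y

/-- The outer submeasure `φ_𝓔` associated to a class `𝓔` of marked weighted sets:
the infimum of total weights of finite subfamilies covering `X` (and `+∞` if there is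
no such cover). -/
noncomputable def phiE (E : Set (Set TT × Finset ℕ × ℝ≥0∞)) (X : Set TT) : ℝ≥0∞ :=
  ⨅ (F : Finset (Set TT × Finset ℕ × ℝ≥0∞)) (_ : ↑F ⊆ E) (_ : X ⊆ ⋃ c ∈ F, c.1),
    ∑ c ∈ F, c.2.2

/-- `X` is `(m,n,φ)`-thin. -/
def IsThin (φ : Set TT → ℝ≥0∞) (m n : ℕ) (X : Set TT) : Prop :=
  ∀ x : TT, ∃ H : Set TT, memB n H ∧ H ⊆ cylSet m x \ X ∧ 1 < φ (piMap m x ⁻¹' H)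

/-- `X` is `(I,φ)`-thin. -/
def IsThinOn (φ : Set TT → ℝ≥0∞) (I : Finset ℕ) (X : Set TT) : Prop :=
  ∀ m ∈ I, ∀ n ∈ I, m < n → IsThin φ m n X

/-- `a_k = 1/(k+5)³`. -/
noncomputable def aK (k : ℕ) : ℝ := 1 / ((k : ℝ) + 5) ^ 3

/-- `M_k = 2^{2k+12} · 2^{(k+4)(k+5)³}`. -/
def MK (k : ℕ) : ℕ := 2 ^ (2 * k + 12) * 2 ^ ((k + 4) * (k + 5) ^ 3)

/-- The weight bound `2^{-k} (M_k / ‖I‖)^{a_k}`. -/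
noncomputable def weightBound (nrm : Finset ℕ → ℕ) (k : ℕ) (I : Finset ℕ) : ℝ≥0∞ :=
  (2 : ℝ≥0∞) ^ (-(k : ℝ)) * ((MK k : ℝ≥0∞) / (nrm I : ℝ≥0∞)) ^ aK k

/-- The class `E_{k,p}` built from the submeasure `φ = ν_{k+1,p}`. -/
noncomputable def EEcl (nrm : Finset ℕ → ℕ) (φ : Set TT → ℝ≥0∞) (k : ℕ) :
    Set (Set TT × Finset ℕ × ℝ≥0∞) :=
  {c | IsClopen c.1 ∧ nrm c.2.1 ≤ MK k ∧ weightBound nrm k c.2.1 ≤ c.2.2 ∧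
       IsThinOn φ c.2.1 c.1}

/-- `Cstage nrm p j = C_{p-j, p}`, defined by downward recursion on `k = p - j`. -/
noncomputable def Cstage (nrm : Finset ℕ → ℕ) (p : ℕ) : ℕ → Set (Set TT × Finset ℕ × ℝ≥0∞)
  | 0 => ∅
  | j + 1 => Cstage nrm p j ∪ EEcl nrm (phiE (Cstage nrm p j)) (p - (j + 1))

/-- The family `C_{k,p}`. -/
noncomputable def Ckp (nrm : Finset ℕ → ℕ) (k p : ℕ) : Set (Set TT × Finset ℕ × ℝ≥0∞) :=
  Cstage nrm p (p - k)

/-- The submeasure `ν_{k,p} = φ_{C_{k,p}}`. -/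
noncomputable def nuKP (nrm : Finset ℕ → ℕ) (k p : ℕ) : Set TT → ℝ≥0∞ :=
  phiE (Ckp nrm k p)

/-- The ultrafilter-limit submeasure `ν_k(E) = lim_{p→𝒰} ν_{k,p}(E)`. -/
noncomputable def nuK (nrm : Finset ℕ → ℕ) (U : Ultrafilter ℕ) (k : ℕ) (X : Set TT) : ℝ≥0∞ :=
  limUnder (U : Filter ℕ) fun p => nuKP nrm k p X

/-- `n(E)`: the least `n` with `E ∈ ℬ_n`. -/
noncomputable def nOf (E : Set TT) : ℕ := sInf {n | memB n E}

/-- `φ` has the covering property: every `E ∈ ℬ` not depending on coordinates `< m`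
with `φ(E) < 2` admits an `m`-covering sequence `(C_r)_{m < r ≤ n(E)}`, i.e. `C_r ∈ ℬ_r`,
`int_j(E) ⊆ ⋃_{m < r ≤ j} C_r` for all `m < j ≤ n(E)`, and `∑_{m < r ≤ n(E)} φ(C_r) ≤ 4`. -/
def CoveringProperty (φ : Set TT → ℝ≥0∞) : Prop :=
  ∀ (m : ℕ) (E : Set TT), IsClopen E → indepBelow m E → φ E < 2 →
    ∃ C : ℕ → Set TT,
      (∀ r, m < r → r ≤ nOf E → memB r (C r)) ∧
      (∀ j, m < j → j ≤ nOf E → intn j E ⊆ ⋃ r ∈ Finset.Ioc m j, C r) ∧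
      ∑ r ∈ Finset.Ioc m (nOf E), φ (C r) ≤ 4

lemma memB_clopen {n : ℕ} {X : Set TT} (h : memB n X) : IsClopen X := by
  have key : ∀ X : Set TT, memB n X → IsOpen X := by
    intro X h
    rw [isOpen_iff_mem_nhds]
    intro x hx
    have : {y : TT | ∀ i < n, y i = x i} ∈ nhds x := by
      have : {y : TT | ∀ i < n, y i = x i} = ⋂ i ∈ Finset.range n, (fun y : TT => y i) ⁻¹' {x i} := by
        ext y; simp
      rw [this]
      apply IsOpen.mem_nhds
      · apply isOpen_biInter_finset
        intro i _
        exact (isOpen_discrete _).preimage (continuous_apply i)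
      · simp
    exact Filter.mem_of_superset this (fun y hy => (h y x hy).2 hx)
  refine ⟨⟨key _ ?_⟩, key _ h⟩
  intro x y hxy
  exact not_congr (h x y hxy)

lemma memB_clsn (n : ℕ) (X : Set TT) : memB n (clsn n X) := by
  intro x y hxy
  constructor
  · rintro ⟨z, hz, h⟩; exact ⟨z, hz, fun i hi => (hxy i hi).symm.trans (h i hi)⟩
  · rintro ⟨z, hz, h⟩; exact ⟨z, hz, fun i hi => (hxy i hi).trans (h i hi)⟩

lemma thin_transfer {φ : Set TT → ℝ≥0∞} {m n : ℕ} {x : TT} {Y : Set TT} {a b : ℕ}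
    (hma : m ≤ a) (hab : a < b) (hbn : b ≤ n) (h : IsThin φ a b Y) :
    IsThin φ a b (clsn n (piMap m x ⁻¹' Y)) := by
  intro u
  obtain ⟨H, hB, hH, hφ⟩ := h (piMap m x u)
  refine ⟨cylSet a u ∩ piMap m x ⁻¹' H, ?_, ?_, ?_⟩
  · have e : ∀ y z : TT, (∀ i < b, y i = z i) → y ∈ cylSet a u ∩ piMap m x ⁻¹' H →
        z ∈ cylSet a u ∩ piMap m x ⁻¹' H := by
      rintro y z hyz ⟨h1, h2⟩
      have h3 : piMap m x z ∈ H := by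
        refine (hB _ _ ?_).1 h2
        intro i hi
        simp only [piMap, hyz i hi]
      refine ⟨?_, h3⟩
      intro i hi
      by_cases hib : i < b
      · rw [← hyz i hib]; exact h1 i hi
      · omega
    intro y z hyz
    exact ⟨e y z hyz, e z y fun i hi => (hyz i hi).symm⟩
  · rintro z ⟨hz, hzH⟩
    refine ⟨hz, ?_⟩
    rintro ⟨y, hy, hzy⟩
    have : piMap m x y ∈ H := by
      refine (hB _ _ ?_).1 hzH
      intro i hi
      simp only [piMap]
      split_ifs
      · rfl
      · exact hzy i (by omega)
    exact (hH this).2 hy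
  · have : piMap a u ⁻¹' (cylSet a u ∩ piMap m x ⁻¹' H) = piMap a (piMap m x u) ⁻¹' H := by
      ext z
      have e : piMap m x (piMap a u z) = piMap a (piMap m x u) z := by
        funext i; simp only [piMap]; split_ifs <;> first | rfl | omega
      simp only [Set.mem_preimage, Set.mem_inter_iff, e]
      constructor
      · exact fun h => h.2
      · refine fun h => ⟨?_, h⟩
        intro i hi; simp [piMap, hi]
    rw [this]; exact hφ

lemma weight_transfer (nrm : Finset ℕ → ℕ) (k R : ℕ) (I J : Finset ℕ) (hR : R ≠ 0)
    (h : nrm I ≤ R * nrm J) :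
    weightBound nrm k J ≤ (R : ℝ≥0∞) ^ aK k * weightBound nrm k I := by
  have ha : 0 ≤ aK k := by unfold aK; positivity
  have h1 : (MK k : ℝ≥0∞) / nrm J ≤ R * ((MK k : ℝ≥0∞) / nrm I) := by
    by_cases hI : nrm I = 0
    · · have : (MK k : ℝ≥0∞) / nrm I = ⊤ := by
          rw [hI]; simp [ENNReal.div_zero, MK]
        rw [this, ENNReal.mul_top (by exact_mod_cast hR)]; exact le_top
    · apply ENNReal.div_le_of_le_mul
      calc (MK k : ℝ≥0∞) = (MK k : ℝ≥0∞) / nrm I * nrm I :=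
            (ENNReal.div_mul_cancel (by exact_mod_cast hI) (by simp)).symm
        _ ≤ (MK k : ℝ≥0∞) / nrm I * (R * nrm J) := by gcongr; exact_mod_cast h
        _ = _ := by ring
  unfold weightBound
  calc _ ≤ (2 : ℝ≥0∞) ^ (-(k : ℝ)) * (R * ((MK k : ℝ≥0∞) / nrm I)) ^ aK k := by gcongr
    _ = _ := by rw [ENNReal.mul_rpow_of_nonneg _ _ ha]; ring

lemma aK_anti {i k : ℕ} (h : k ≤ i) : aK i ≤ aK k := by
  unfold aK
  have : (k : ℝ) ≤ i := by exact_mod_cast h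
  gcongr

lemma cstage_transfer {nrm : Finset ℕ → ℕ} (hn : IsAdmissibleNorm nrm) (p m n R : ℕ) (hR : 1 ≤ R)
    (x : TT) : ∀ (j : ℕ) (c : Set TT × Finset ℕ × ℝ≥0∞), c ∈ Cstage nrm p j →
    nrm c.2.1 ≤ R * nrm (c.2.1 ∩ Finset.Icc m n) →
    (clsn n (piMap m x ⁻¹' c.1), c.2.1 ∩ Finset.Icc m n, (R : ℝ≥0∞) ^ aK (p - j) * c.2.2)
      ∈ Cstage nrm p j := by
  have key : ∀ (φ : Set TT → ℝ≥0∞) (i k : ℕ) (c : Set TT × Finset ℕ × ℝ≥0∞), k ≤ i → c ∈ EEcl nrm φ i →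
    nrm c.2.1 ≤ R * nrm (c.2.1 ∩ Finset.Icc m n) →
    (clsn n (piMap m x ⁻¹' c.1), c.2.1 ∩ Finset.Icc m n, (R : ℝ≥0∞) ^ aK k * c.2.2)
      ∈ EEcl nrm φ i := by
    rintro φ i k ⟨Y, I, w⟩ hki ⟨h1, h2, h3, h4⟩ h
    refine ⟨memB_clopen (memB_clsn _ _), (hn.mono _ _ Finset.inter_subset_left).trans h2, ?_, ?_⟩
    · refine (weight_transfer nrm i R I _ (by omega) h).trans ?_
      have hR' : (1 : ℝ≥0∞) ≤ R := by exact_mod_cast hR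
      exact mul_le_mul' (ENNReal.rpow_le_rpow_of_exponent_le hR' (aK_anti hki)) h3
    · intro a ha b hb hab
      simp only [Finset.mem_inter, Finset.mem_Icc] at ha hb
      exact thin_transfer ha.2.1 hab hb.2.2 (h4 a ha.1 b hb.1 hab)
  have key2 : ∀ (k j : ℕ) (c : Set TT × Finset ℕ × ℝ≥0∞), k ≤ p - j → c ∈ Cstage nrm p j →
    nrm c.2.1 ≤ R * nrm (c.2.1 ∩ Finset.Icc m n) →
    (clsn n (piMap m x ⁻¹' c.1), c.2.1 ∩ Finset.Icc m n, (R : ℝ≥0∞) ^ aK k * c.2.2)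
      ∈ Cstage nrm p j := by
    intro k j
    induction j with
    | zero => intro c _ hc; exact absurd hc (by simp [Cstage])
    | succ j ih =>
      intro c hk hc h
      rcases hc with hc | hc
      · exact Or.inl (ih c (by omega) hc h)
      · exact Or.inr (key _ _ _ c hk hc h)
  intro j c
  exact key2 _ j c le_rfl

lemma phiE_le {E : Set (Set TT × Finset ℕ × ℝ≥0∞)} {ι : Type*} (G : Finset ι)
    (f : ι → Set TT × Finset ℕ × ℝ≥0∞) (hf : ∀ c ∈ G, f c ∈ E) {X : Set TT}
    (hX : ∀ x ∈ X, ∃ c ∈ G, x ∈ (f c).1) : phiE E X ≤ ∑ c ∈ G, (f c).2.2 := by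
  classical
  unfold phiE
  refine (iInf_le _ (G.image f)).trans ?_
  refine (iInf_le _ ?_).trans ?_
  · intro c hc
    simp only [Finset.coe_image, Set.mem_image] at hc
    obtain ⟨d, hd, rfl⟩ := hc
    exact hf d hd
  refine (iInf_le _ ?_).trans ?_
  · intro x hx
    obtain ⟨c, hc, h⟩ := hX x hx
    simp only [Set.mem_iUnion]
    exact ⟨f c, Finset.mem_image_of_mem f hc, h⟩
  · exact Finset.sum_image_le_of_nonneg (g := f) (f := fun c => c.2.2) (by simp)

lemma phiE_lt {E : Set (Set TT × Finset ℕ × ℝ≥0∞)} {X : Set TT} {c : ℝ≥0∞} (h : phiE E X < c) :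
    ∃ F : Finset (Set TT × Finset ℕ × ℝ≥0∞), ↑F ⊆ E ∧ (∀ x ∈ X, ∃ c ∈ F, x ∈ c.1) ∧
      ∑ c ∈ F, c.2.2 < c := by
  unfold phiE at h
  simp only [iInf_lt_iff] at h
  obtain ⟨F, h1, h2, h3⟩ := h
  refine ⟨F, h1, ?_, h3⟩
  intro x hx
  simpa using h2 hx

lemma avoid {nrm : Finset ℕ → ℕ} (hn : IsAdmissibleNorm nrm) (p m n R j : ℕ) (hR : 1 ≤ R) (hmn : m ≤ n)
    (x : TT) (G : Finset (Set TT × Finset ℕ × ℝ≥0∞)) (hG : ∀ c ∈ G, c ∈ Cstage nrm p j)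
    (hGn : ∀ c ∈ G, nrm c.2.1 ≤ R * nrm (c.2.1 ∩ Finset.Icc m n)) (Z : Set TT)
    (hZ : (R : ℝ≥0∞) ^ aK (p - j) * ∑ c ∈ G, c.2.2 < phiE (Cstage nrm p j) Z) :
    ∃ z ∈ Z, ∀ c ∈ G, ∀ y ∈ cylSet n (piMap m x z), y ∉ c.1 := by
  by_contra hcon
  push Not at hcon
  refine absurd hZ (not_lt.2 ?_)
  rw [Finset.mul_sum]
  refine phiE_le G (fun c => (clsn n (piMap m x ⁻¹' c.1), c.2.1 ∩ Finset.Icc m n,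
    (R : ℝ≥0∞) ^ aK (p - j) * c.2.2))
    (fun c hc => cstage_transfer hn p m n R hR x j c (hG c hc) (hGn c hc)) ?_
  intro z hz
  obtain ⟨c, hc, y, hy, hyc⟩ := hcon z hz
  refine ⟨c, hc, fun i => if i < m then z i else y i, ?_, ?_⟩
  · have e : piMap m x (fun i => if i < m then z i else y i) = y := by
      funext i
      simp only [piMap]
      split_ifs with h
      · have := hy i (by omega)
        simp only [piMap, if_pos h] at this
        exact this.symm
      · rfl
    simp only [Set.mem_preimage, e]; exact hyc
  · intro i hi
    have := hy i hi
    simp only [piMap] at this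
    by_cases h : i < m
    · simp [h]
    · simp only [h, if_false] at this ⊢; exact this.symm

lemma nrm_biUnion {nrm : Finset ℕ → ℕ} (hn : IsAdmissibleNorm nrm) {ι : Type*}
    (S : Finset ι) (J : ι → Finset ℕ) (I : Finset ℕ) (h : ∀ i ∈ I, ∃ l ∈ S, i ∈ J l) :
    nrm I ≤ ∑ l ∈ S, nrm (I ∩ J l) := by
  classical
  have key : ∀ S : Finset ι, nrm (S.biUnion fun l => I ∩ J l) ≤ ∑ l ∈ S, nrm (I ∩ J l) := by
    intro S
    induction S using Finset.induction_on with
    | empty => simp [hn.empty]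
    | insert a S ha ih =>
      rw [Finset.biUnion_insert, Finset.sum_insert ha]
      exact (hn.subadd _ _).trans (by gcongr)
  refine (hn.mono _ _ ?_).trans (key S)
  intro i hi
  obtain ⟨l, hl, h⟩ := h i hi
  simp only [Finset.mem_biUnion, Finset.mem_inter]
  exact ⟨l, hl, hi, h⟩

lemma nrm_le_card {nrm : Finset ℕ → ℕ} (hn : IsAdmissibleNorm nrm) (I : Finset ℕ) :
    nrm I ≤ I.card := by
  induction I using Finset.induction_on with
  | empty => simp [hn.empty]
  | insert a S ha ih =>
    rw [Finset.card_insert_of_notMem ha, Finset.insert_eq]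
    refine (hn.subadd _ _).trans ?_
    rw [hn.singleton]; omega

lemma blocks {α : Type*} [Inhabited α] (I : α → Finset ℕ) (t : ℕ) :
    ∀ (s : ℕ) (S : Finset α), S.card = s → ∀ b : ℕ,
    (∀ a ∈ S, s * (t + 1) ≤ ((I a).filter (b ≤ ·)).card) →
    ∃ (e : ℕ → α) (g : ℕ → ℕ → ℕ), (∀ a ∈ S, ∃ l < s, e l = a) ∧ (∀ l < s, e l ∈ S) ∧
      (∀ l < s, ∀ v ≤ t, b ≤ g l v ∧ g l v ∈ I (e l)) ∧
      (∀ l < s, ∀ v v', v < v' → v' ≤ t → g l v < g l v') ∧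
      (∀ l l', l < l' → l' < s → g l t ≤ g l' 0) := by
  classical
  intro s
  induction s with
  | zero =>
    intro S hS b _
    rw [Finset.card_eq_zero] at hS
    subst hS
    exact ⟨fun _ => default, fun _ _ => 0, by simp⟩
  | succ s ih =>
    intro S hS b hb
    obtain ⟨P, hP⟩ : ∃ P : α → ℕ → Prop, ∀ a i, P a i ↔ i ∈ I a ∧ b ≤ i := ⟨_, fun _ _ => Iff.rfl⟩
    have hfin : ∀ a, {i | P a i}.Finite := fun a =>
      (I a).finite_toSet.subset (fun i hi => ((hP a i).1 hi).1)
    have hcard : ∀ a, (hfin a).toFinset = (I a).filter (b ≤ ·) := by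
      intro a; ext i; simp [hP]
    have hlt : ∀ a ∈ S, t < (hfin a).toFinset.card := by
      intro a ha
      rw [hcard]
      have := hb a ha
      nlinarith
    have hne : S.Nonempty := by rw [← Finset.card_pos]; omega
    obtain ⟨a0, ha0, hmin⟩ := S.exists_min_image (fun a => Nat.nth (P a) t) hne
    obtain ⟨e, g, h1, h2, h3, h4, h5⟩ := ih (S.erase a0)
      (by rw [Finset.card_erase_of_mem ha0, hS]; rfl) (Nat.nth (P a0) t + 1) (by
        intro a ha
        have haS := Finset.mem_of_mem_erase ha
        have hc : Nat.count (P a) (Nat.nth (P a0) t + 1) ≤ t + 1 := by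
          refine (Nat.count_monotone (P a) (Nat.succ_le_succ (hmin a haS))).trans ?_
          exact (Nat.count_nth_succ (fun hf => hlt a haS)).le
        rw [Nat.count_eq_card_filter_range] at hc
        have hsub : (I a).filter (b ≤ ·) ⊆
            (Finset.range (Nat.nth (P a0) t + 1)).filter (fun x => P a x) ∪
            (I a).filter (Nat.nth (P a0) t + 1 ≤ ·) := by
          intro i hi
          simp only [Finset.mem_filter, Finset.mem_union, Finset.mem_range, hP] at hi ⊢
          by_cases hh : i < Nat.nth (P a0) t + 1
          · exact Or.inl ⟨hh, hi⟩
          · exact Or.inr ⟨hi.1, not_lt.1 hh⟩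
        have := (Finset.card_le_card hsub).trans (Finset.card_union_le _ _)
        have := hb a haS
        have e1 : (s + 1) * (t + 1) = s * (t + 1) + (t + 1) := by ring
        omega)
    have hmem : ∀ v ≤ t, P a0 (Nat.nth (P a0) v) := fun v hv =>
      Nat.nth_mem v (fun hf => lt_of_le_of_lt hv (hlt a0 ha0))
    refine ⟨fun l => Nat.casesOn l a0 e, fun l => Nat.casesOn l (Nat.nth (P a0)) g, ?_, ?_, ?_, ?_, ?_⟩
    · intro a ha
      by_cases haa : a = a0
      · exact ⟨0, by omega, haa.symm⟩
      · obtain ⟨l, hl, he⟩ := h1 a (Finset.mem_erase.2 ⟨haa, ha⟩)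
        exact ⟨l + 1, by omega, he⟩
    · rintro (_ | l) hl
      · exact ha0
      · exact Finset.mem_of_mem_erase (h2 l (by omega))
    · rintro (_ | l) hl v hv
      · exact ⟨((hP _ _).1 (hmem v hv)).2, ((hP _ _).1 (hmem v hv)).1⟩
      · have := h3 l (by omega) v hv
        have h0 := ((hP _ _).1 (hmem t le_rfl)).2
        exact ⟨by have := this.1; simp only; omega, this.2⟩
    · rintro (_ | l) hl v v' hv hv'
      · exact Nat.nth_lt_nth' hv (fun hf => lt_of_le_of_lt hv' (hlt a0 ha0))
      · exact h4 l (by omega) v v' hv hv'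
    · rintro (_ | l) (_ | l') hl hl'
      · omega
      · have := (h3 l' (by omega) 0 (Nat.zero_le _)).1
        exact (Nat.le_succ _).trans this
      · omega
      · exact h5 l l' (by omega) (by omega)

noncomputable def cK (k : ℕ) : ℝ≥0∞ := (2 : ℝ≥0∞) ^ (4 - 1 / ((k : ℝ) + 5))

lemma cK_le (k : ℕ) : cK k ≤ 16 := by
  have : (16 : ℝ≥0∞) = 2 ^ (4 : ℝ) := by norm_num
  rw [this]
  apply ENNReal.rpow_le_rpow_of_exponent_le (by norm_num)
  have : 0 ≤ 1 / ((k : ℝ) + 5) := by positivity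
  linarith

lemma le_cK (k : ℕ) : 8 ≤ cK k := by
  have : (8 : ℝ≥0∞) = 2 ^ (3 : ℝ) := by norm_num
  rw [this]
  apply ENNReal.rpow_le_rpow_of_exponent_le (by norm_num)
  have : 1 / ((k : ℝ) + 5) ≤ 1 := by
    rw [div_le_one (by positivity)]
    have : (0 : ℝ) ≤ k := by positivity
    linarith
  linarith

lemma R_pow (k : ℕ) : (((2 ^ (k + 6) : ℕ) : ℝ≥0∞)) ^ aK (k + 1) =
    (2 : ℝ≥0∞) ^ (1 / ((k : ℝ) + 6) ^ 2) := by
  have : (((2 ^ (k + 6) : ℕ) : ℝ≥0∞)) = 2 ^ ((k : ℝ) + 6) := by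
    have : ((k : ℝ) + 6) = ((k + 6 : ℕ) : ℝ) := by push_cast; ring
    rw [this, ENNReal.rpow_natCast]; push_cast; rfl
  rw [this, ← ENNReal.rpow_mul]
  congr 1
  unfold aK
  push_cast
  have : (k : ℝ) + 6 ≠ 0 := by positivity
  have e : (k : ℝ) + 1 + 5 = k + 6 := by ring
  rw [e]
  field_simp

lemma R_pow_le (k : ℕ) : (((2 ^ (k + 6) : ℕ) : ℝ≥0∞)) ^ aK (k + 1) ≤ 2 := by
  rw [R_pow]
  have : (2 : ℝ≥0∞) = 2 ^ (1 : ℝ) := by norm_num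
  conv_rhs => rw [this]
  apply ENNReal.rpow_le_rpow_of_exponent_le (by norm_num)
  rw [div_le_one (by positivity)]
  have : (0 : ℝ) ≤ k := by positivity
  nlinarith

lemma cK_step (k : ℕ) : (((2 ^ (k + 6) : ℕ) : ℝ≥0∞)) ^ aK (k + 1) * cK k ≤ cK (k + 1) := by
  rw [R_pow]
  unfold cK
  rw [← ENNReal.rpow_add _ _ (by norm_num) (by norm_num)]
  apply ENNReal.rpow_le_rpow_of_exponent_le (by norm_num)
  push_cast
  have : (0 : ℝ) ≤ k := by positivity
  have e : (k : ℝ) + 1 + 5 = k + 6 := by ring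
  rw [e]
  have h : 1 / ((k : ℝ) + 6) ^ 2 ≤ 1 / ((k : ℝ) + 5) - 1 / (k + 6) := by
    rw [div_sub_div _ _ (by positivity) (by positivity), div_le_div_iff₀ (by positivity) (by positivity)]
    nlinarith
  linarith

lemma wb_zero (nrm : Finset ℕ → ℕ) (k : ℕ) (I : Finset ℕ) (h : nrm I = 0) :
    weightBound nrm k I = ⊤ := by
  unfold weightBound
  have ha : 0 < aK k := by unfold aK; positivity
  rw [h, Nat.cast_zero, ENNReal.div_zero (by simp [MK]), ENNReal.top_rpow_of_pos ha,
    ENNReal.mul_top]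
  simp [ENNReal.rpow_eq_zero_iff]

lemma wb_ge (nrm : Finset ℕ → ℕ) (k : ℕ) (I : Finset ℕ) (h : nrm I ≤ MK k) :
    1 ≤ 2 ^ k * weightBound nrm k I := by
  have ha : 0 < aK k := by unfold aK; positivity
  unfold weightBound
  rw [← mul_assoc, ENNReal.rpow_neg, ENNReal.rpow_natCast, ENNReal.mul_inv_cancel (by simp) (by simp),
    one_mul]
  apply ENNReal.one_le_rpow _ ha
  rw [ENNReal.le_div_iff_mul_le (by simp [MK]) (by simp)]
  rw [one_mul]; exact_mod_cast h

lemma wb_big (nrm : Finset ℕ → ℕ) (k : ℕ) (I : Finset ℕ) (h : weightBound nrm k I ≤ 16) :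
    2 ^ (2 * k + 12) ≤ nrm I := by
  have h0 : nrm I ≠ 0 := by
    intro h0; rw [wb_zero _ _ _ h0] at h; simp at h
  have ha : 0 < aK k := by unfold aK; positivity
  have h1 : ((MK k : ℝ≥0∞) / nrm I) ^ aK k ≤ 2 ^ ((k : ℝ) + 4) := by
    have : ((MK k : ℝ≥0∞) / nrm I) ^ aK k = 2 ^ (k : ℝ) * weightBound nrm k I := by
      unfold weightBound
      rw [← mul_assoc, ENNReal.rpow_neg, ENNReal.rpow_natCast,
        ENNReal.mul_inv_cancel (by simp) (by simp), one_mul]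
    rw [this, ENNReal.rpow_add _ _ (by norm_num) (by norm_num)]
    gcongr
    refine h.trans (le_of_eq (by norm_num))
  have h2 : (MK k : ℝ≥0∞) / nrm I ≤ 2 ^ ((k + 4) * (k + 5) ^ 3) := by
    rw [← ENNReal.le_rpow_inv_iff ha] at h1
    refine h1.trans (le_of_eq ?_)
    rw [← ENNReal.rpow_mul, ← ENNReal.rpow_natCast]
    congr 1
    unfold aK
    push_cast
    simp
  rw [ENNReal.div_le_iff (by exact_mod_cast h0) (by simp)] at h2
  have h3 : MK k ≤ 2 ^ ((k + 4) * (k + 5) ^ 3) * nrm I := by exact_mod_cast h2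
  unfold MK at h3
  rw [mul_comm] at h3
  exact Nat.le_of_mul_le_mul_left h3 (by positivity)

lemma cstage_nrm {nrm : Finset ℕ → ℕ} {p : ℕ} : ∀ (j : ℕ) (c : Set TT × Finset ℕ × ℝ≥0∞),
    c ∈ Cstage nrm p j → c.2.2 ≠ ⊤ → nrm c.2.1 ≠ 0 := by
  intro j
  induction j with
  | zero => intro c hc; exact absurd hc (by simp [Cstage])
  | succ j ih =>
    rintro c (hc | hc) h h0
    · exact ih c hc h h0
    · have := hc.2.2.1
      rw [wb_zero _ _ _ h0] at this
      exact h (top_le_iff.1 this)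

def loB (g : ℕ → ℕ → ℕ) (v l : ℕ) : ℕ := if l = 0 then 0 else g (l - 1) (v + 1)
def hiB (g : ℕ → ℕ → ℕ) (s N v l : ℕ) : ℕ := if l < s then g l v else N

lemma cov_gap (g : ℕ → ℕ → ℕ) (s N v i : ℕ) (hi : i ≤ N) :
    (∃ l ≤ s, loB g v l ≤ i ∧ i ≤ hiB g s N v l) ∨ ∃ l < s, g l v ≤ i ∧ i < g l (v + 1) := by
  by_contra hcon
  push Not at hcon
  obtain ⟨h1, h2⟩ := hcon
  have key : ∀ l ≤ s, loB g v l ≤ i := by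
    intro l
    induction l with
    | zero => intro _; simp [loB]
    | succ l ih =>
      intro hl
      have a := h1 l (by omega) (ih (by omega))
      simp only [hiB, if_pos (show l < s by omega)] at a
      have := h2 l (by omega) a.le
      simpa [loB] using this
  have := h1 s le_rfl (key s le_rfl)
  simp [hiB] at this
  omega

def badB (nrm : Finset ℕ → ℕ) (g : ℕ → ℕ → ℕ) (s N R v : ℕ) (c : Set TT × Finset ℕ × ℝ≥0∞) : Prop :=
  ∀ l ≤ s, R * nrm (c.2.1 ∩ Finset.Icc (loB g v l) (hiB g s N v l)) < nrm c.2.1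

open Classical in
lemma choose_v {nrm : Finset ℕ → ℕ} (hn : IsAdmissibleNorm nrm) (g : ℕ → ℕ → ℕ) (s N R t : ℕ)
    (ht : 0 < t)
    (hmono : ∀ l < s, ∀ v v', v < v' → v' ≤ t → g l v < g l v')
    (hord : ∀ l l', l < l' → l' < s → g l t ≤ g l' 0)
    (hR : 2 * (s + 1) ≤ R)
    (F : Finset (Set TT × Finset ℕ × ℝ≥0∞)) (hF : ∀ c ∈ F, ∀ i ∈ c.2.1, i ≤ N) :
    ∃ v < t, ∑ c ∈ F.filter (badB nrm g s N R v), c.2.2 ≤ (∑ c ∈ F, c.2.2) / t := by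
  have hmono' : ∀ l < s, ∀ v v', v ≤ v' → v' ≤ t → g l v ≤ g l v' := by
    intro l hl v v' h h'
    rcases h.eq_or_lt with rfl | h
    · exact le_rfl
    · exact (hmono l hl v v' h h').le
  have huniq : ∀ c ∈ F, ∀ v < t, ∀ v' < t, v < v' → badB nrm g s N R v c → badB nrm g s N R v' c →
      False := by
    intro c hc v hv v' hv' hne hb hb'
    have hcov : ∀ i ∈ c.2.1, ∃ q ∈ (Finset.range (s + 1) ×ˢ ({v, v'} : Finset ℕ)),
        i ∈ Finset.Icc (loB g q.2 q.1) (hiB g s N q.2 q.1) := by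
      intro i hi
      simp only [Finset.mem_product, Finset.mem_range, Finset.mem_insert, Finset.mem_singleton,
        Finset.mem_Icc, Prod.exists]
      rcases cov_gap g s N v i (hF c hc i hi) with ⟨l, hl, h⟩ | ⟨l, hl, h1, h2⟩
      · exact ⟨l, v, ⟨by omega, Or.inl rfl⟩, h⟩
      rcases cov_gap g s N v' i (hF c hc i hi) with ⟨l', hl', h⟩ | ⟨l', hl', h1', h2'⟩
      · exact ⟨l', v', ⟨by omega, Or.inr rfl⟩, h⟩
      exfalso
      have a1 := hmono' l hl 0 v (by omega) (by omega)
      have a2 := hmono' l hl (v + 1) t (by omega) (by omega)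
      have b1 := hmono' l' hl' 0 v' (by omega) (by omega)
      have b2 := hmono' l' hl' (v' + 1) t (by omega) (by omega)
      rcases lt_trichotomy l l' with h | rfl | h
      · have := hord l l' h hl'; omega
      · have := hmono' l hl (v + 1) v' (by omega) (by omega); omega
      · have := hord l' l h hl; omega
    have h1 := nrm_biUnion hn _ (fun q : ℕ × ℕ => Finset.Icc (loB g q.2 q.1) (hiB g s N q.2 q.1)) _ hcov
    have h2 : R * nrm c.2.1 < R * nrm c.2.1 := by
      calc R * nrm c.2.1 ≤ ∑ q ∈ (Finset.range (s + 1) ×ˢ ({v, v'} : Finset ℕ)),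
            R * nrm (c.2.1 ∩ Finset.Icc (loB g q.2 q.1) (hiB g s N q.2 q.1)) := by
              rw [← Finset.mul_sum]; exact Nat.mul_le_mul_left _ h1
        _ < ∑ q ∈ (Finset.range (s + 1) ×ˢ ({v, v'} : Finset ℕ)), nrm c.2.1 := by
            apply Finset.sum_lt_sum_of_nonempty
            · exact ⟨(0, v), by simp⟩
            · rintro ⟨l, u⟩ hq
              simp only [Finset.mem_product, Finset.mem_range, Finset.mem_insert,
                Finset.mem_singleton] at hq
              rcases hq with ⟨hl, rfl | rfl⟩
              · exact hb l (by omega)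
              · exact hb' l (by omega)
        _ = (2 * (s + 1)) * nrm c.2.1 := by
            rw [Finset.sum_const, Finset.card_product, Finset.card_range,
              Finset.card_pair hne.ne, _root_.smul_eq_mul]; ring
        _ ≤ _ := Nat.mul_le_mul_right _ hR
    exact lt_irrefl _ h2
  have havg : ∑ v ∈ Finset.range t, ∑ c ∈ F.filter (badB nrm g s N R v), c.2.2 ≤
      ∑ v ∈ Finset.range t, (∑ c ∈ F, c.2.2) / t := by
    have e : ∑ v ∈ Finset.range t, (∑ c ∈ F, c.2.2) / (t : ℝ≥0∞) = ∑ c ∈ F, c.2.2 := by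
      rw [Finset.sum_const, Finset.card_range, _root_.nsmul_eq_mul]
      exact ENNReal.mul_div_cancel (by exact_mod_cast ht.ne') (by simp)
    rw [e]
    simp only [Finset.sum_filter]
    rw [Finset.sum_comm]
    apply Finset.sum_le_sum
    intro c hc
    rw [← Finset.sum_filter, Finset.sum_const]
    have : ((Finset.range t).filter (fun v => badB nrm g s N R v c)).card ≤ 1 := by
      rw [Finset.card_le_one]
      intro a ha b hb
      simp only [Finset.mem_filter, Finset.mem_range] at ha hb
      rcases lt_trichotomy a b with h | h | h
      · exact (huniq c hc a ha.1 b hb.1 h ha.2 hb.2).elim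
      · exact h
      · exact (huniq c hc b hb.1 a ha.1 h hb.2 ha.2).elim
    calc _ ≤ 1 • c.2.2 := nsmul_le_nsmul_left (by simp) this
      _ = _ := one_nsmul _
  obtain ⟨v, hv, h⟩ := ENNReal.exists_le_of_sum_le (by simpa using ht.ne') havg
  exact ⟨v, Finset.mem_range.1 hv, h⟩

open Classical in
lemma main_step {nrm : Finset ℕ → ℕ} (hn : IsAdmissibleNorm nrm) (p j k : ℕ)
    (hk : p - (j + 1) = k) (hk' : p - j = k + 1)
    (ih : cK (k + 1) ≤ phiE (Cstage nrm p j) Set.univ) :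
    cK k ≤ phiE (Cstage nrm p (j + 1)) Set.univ := by
  by_contra hcon
  obtain ⟨F, hFE, hFcov, hFw⟩ := phiE_lt (not_le.1 hcon)
  set F' := F.filter (· ∈ Cstage nrm p j) with hF'
  set Fk := F.filter (· ∉ Cstage nrm p j) with hFk
  have hFkE : ∀ c ∈ Fk, c ∈ EEcl nrm (phiE (Cstage nrm p j)) k := by
    intro c hc
    rw [hFk, Finset.mem_filter] at hc
    rcases hFE hc.1 with h | h
    · exact absurd h hc.2
    · rwa [hk] at h
  have hw16 : ∀ c ∈ F, c.2.2 ≤ 16 := fun c hc =>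
    (Finset.single_le_sum (f := fun c : Set TT × Finset ℕ × ℝ≥0∞ => c.2.2) (by simp) hc).trans
      (hFw.le.trans (cK_le k))
  have hF'w : ∑ c ∈ F', c.2.2 < cK k :=
    (Finset.sum_le_sum_of_subset (Finset.filter_subset _ _)).trans_lt hFw
  have hs : Fk.card ≤ 2 ^ (k + 4) := by
    have h1 : (Fk.card : ℝ≥0∞) ≤ 2 ^ (k + 4) := by
      calc (Fk.card : ℝ≥0∞) = ∑ c ∈ Fk, 1 := by simp
        _ ≤ ∑ c ∈ Fk, 2 ^ k * c.2.2 := by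
          apply Finset.sum_le_sum
          intro c hc
          have := hFkE c hc
          exact (wb_ge nrm k c.2.1 this.2.1).trans (by gcongr; exact this.2.2.1)
        _ = 2 ^ k * ∑ c ∈ Fk, c.2.2 := by rw [Finset.mul_sum]
        _ ≤ 2 ^ k * 16 := by
          gcongr
          exact (Finset.sum_le_sum_of_subset (Finset.filter_subset _ _)).trans
            (hFw.le.trans (cK_le k))
        _ = 2 ^ (k + 4) := by rw [pow_add]; norm_num
    exact_mod_cast h1
  obtain ⟨s, hsdef⟩ : ∃ s, Fk.card = s := ⟨_, rfl⟩
  rw [hsdef] at hs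
  obtain ⟨e, g, he, heF, hgI, hmono, hord⟩ := blocks (fun c : Set TT × Finset ℕ × ℝ≥0∞ => c.2.1) 32 s Fk hsdef 0 (by
    intro c hc
    have h1 := wb_big nrm k c.2.1 ((hFkE c hc).2.2.1.trans (hw16 c (Finset.mem_filter.1 hc).1))
    have h2 := nrm_le_card hn c.2.1
    have h3 : Finset.filter (fun x => 0 ≤ x) c.2.1 = c.2.1 := by simp
    rw [h3]
    have h4 : s * (32 + 1) ≤ 2 ^ (k + 4) * 64 := Nat.mul_le_mul hs (by norm_num)
    have h5 : 2 ^ (k + 4) * 64 ≤ 2 ^ (2 * k + 12) := by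
      rw [show 64 = 2 ^ 6 by norm_num, ← pow_add]
      exact Nat.pow_le_pow_right (by norm_num) (by omega)
    omega)
  obtain ⟨N, hN⟩ : ∃ N, ∀ c ∈ F, ∀ i ∈ c.2.1, i ≤ N := by
    refine ⟨(F.biUnion fun c => c.2.1).sup id, fun c hc i hi => ?_⟩
    exact Finset.le_sup (f := id) (Finset.mem_biUnion.2 ⟨c, hc, hi⟩)
  set R := 2 ^ (k + 6) with hRdef
  have hR : 2 * (s + 1) ≤ R := by
    have : 1 ≤ 2 ^ (k + 4) := Nat.one_le_two_pow
    have : R = 2 ^ (k + 4) * 4 := by rw [hRdef]; ring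
    omega
  have hR1 : 1 ≤ R := by omega
  obtain ⟨v, hv, hbad⟩ := choose_v hn g s N R 32 (by norm_num) hmono hord hR F'
    (fun c hc => hN c (Finset.mem_filter.1 hc).1)
  set Bd := F'.filter (badB nrm g s N R v) with hBd
  have hgN : ∀ l < s, ∀ u ≤ 32, g l u ≤ N := fun l hl u hu =>
    hN _ (Finset.mem_filter.1 (heF l hl)).1 _ (hgI l hl u hu).2
  have hlohi : ∀ l ≤ s, loB g v l ≤ hiB g s N v l := by
    intro l hl
    unfold loB hiB
    by_cases h0 : l = 0
    · simp [h0]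
    rw [if_neg h0]
    split_ifs with h
    · have h1 := hord (l - 1) l (by omega) h
      have h2 : g (l - 1) (v + 1) ≤ g (l - 1) 32 := by
        rcases (show v + 1 ≤ 32 by omega).eq_or_lt with h | h
        · rw [h]
        · exact (hmono (l - 1) (by omega) _ _ h le_rfl).le
      have h3 : g l 0 ≤ g l v := by
        rcases (Nat.zero_le v).eq_or_lt with h' | h'
        · rw [← h']
        · exact (hmono l (by omega) _ _ h' (by omega)).le
      omega
    · exact hgN _ (by omega) _ (by omega)
  have hF'C : ∀ c ∈ F', c ∈ Cstage nrm p j := fun c hc => (Finset.mem_filter.1 hc).2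
  let Gp : ℕ → Finset (Set TT × Finset ℕ × ℝ≥0∞) := fun l =>
    F'.filter fun c => nrm c.2.1 ≤ R * nrm (c.2.1 ∩ Finset.Icc (loB g v l) (hiB g s N v l))
  let Bp : ℕ → Finset (Set TT × Finset ℕ × ℝ≥0∞) := fun l =>
    Bd.filter fun c => nrm c.2.1 ≤ R * nrm (c.2.1 ∩ Finset.Icc (g l v) (g l (v + 1)))
  -- gap step
  have gap : ∀ l ≤ s, ∀ x : TT, ∃ x' : TT, (∀ i < loB g v l, x' i = x i) ∧
      ∀ c ∈ Gp l, ∀ y ∈ cylSet (hiB g s N v l) x', y ∉ c.1 := by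
    intro l hl x
    obtain ⟨z, -, hz⟩ := avoid hn p (loB g v l) (hiB g s N v l) R j hR1 (hlohi l hl) x (Gp l)
      (fun c hc => hF'C c (Finset.mem_filter.1 hc).1) (fun c hc => (Finset.mem_filter.1 hc).2)
      Set.univ (by
        refine lt_of_lt_of_le ?_ ih
        refine lt_of_lt_of_le ?_ (cK_step k)
        rw [hk']
        have h1 : ∑ c ∈ Gp l, c.2.2 < cK k :=
          (Finset.sum_le_sum_of_subset (Finset.filter_subset _ _)).trans_lt hF'w
        refine ENNReal.mul_lt_mul_right ?_ ?_ h1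
        · rw [R_pow]; simp [ENNReal.rpow_eq_zero_iff]
        · exact ne_top_of_le_ne_top (by norm_num) (R_pow_le k))
    exact ⟨_, fun i hi => by simp [piMap, hi], hz⟩
  -- window step
  have win : ∀ l < s, ∀ x : TT, ∃ x' : TT, (∀ i < g l v, x' i = x i) ∧
      (∀ c ∈ Bp l, ∀ y ∈ cylSet (g l (v + 1)) x', y ∉ c.1) ∧
      ∀ y ∈ cylSet (g l (v + 1)) x', y ∉ (e l).1 := by
    intro l hl x
    have hlt := hmono l hl v (v + 1) (by omega) (by omega)
    obtain ⟨H, hB, hH, hφ⟩ := (hFkE _ (heF l hl)).2.2.2 (g l v) (hgI l hl v (by omega)).2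
      (g l (v + 1)) (hgI l hl (v + 1) (by omega)).2 hlt x
    obtain ⟨z, hzH, hz⟩ := avoid hn p (g l v) (g l (v + 1)) R j hR1 hlt.le x (Bp l)
      (fun c hc => hF'C c (Finset.mem_filter.1 (Finset.mem_filter.1 hc).1).1)
      (fun c hc => (Finset.mem_filter.1 hc).2) (piMap (g l v) x ⁻¹' H) (by
        refine lt_of_le_of_lt ?_ hφ
        rw [hk']
        have h1 : ∑ c ∈ Bp l, c.2.2 ≤ 16 / 32 := by
          refine (Finset.sum_le_sum_of_subset (Finset.filter_subset _ _)).trans (hbad.trans ?_)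
          have := hF'w.le.trans (cK_le k)
          push_cast
          gcongr
        refine (mul_le_mul' (R_pow_le k) h1).trans ?_
        rw [← mul_div_assoc]
        apply ENNReal.div_le_of_le_mul
        norm_num)
    refine ⟨_, fun i hi => by simp [piMap, hi], hz, ?_⟩
    intro y hy hyc
    exact (hH ((hB _ _ hy).2 hzH)).2 hyc
  have walk : ∀ l ≤ s, ∃ x : TT, ∀ y ∈ cylSet (loB g v l) x, ∀ i < l,
      (∀ c ∈ Gp i, y ∉ c.1) ∧ (∀ c ∈ Bp i, y ∉ c.1) ∧ y ∉ (e i).1 := by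
    intro l
    induction l with
    | zero => intro _; exact ⟨fun _ => 0, fun y _ i hi => by omega⟩
    | succ l ihl =>
      intro hl
      obtain ⟨x, hx⟩ := ihl (by omega)
      obtain ⟨x1, hx1, hx1'⟩ := gap l (by omega) x
      obtain ⟨x2, hx2, hx2', hx2''⟩ := win l (by omega) x1
      have hhi : hiB g s N v l = g l v := by simp [hiB, show l < s by omega]
      have hlo := hlohi l (by omega)
      have hlt := hmono l (by omega) v (v + 1) (by omega) (by omega)
      rw [hhi] at hx1' hlo
      refine ⟨x2, fun y hy i hi => ?_⟩
      have hy' : ∀ i < g l (v + 1), y i = x2 i := by simpa [loB, cylSet] using hy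
      rcases (Nat.lt_succ_iff.1 hi).eq_or_lt with rfl | hi'
      · refine ⟨fun c hc => hx1' c hc y ?_, fun c hc => hx2' c hc y hy', hx2'' y hy'⟩
        intro a ha
        rw [hy' a (by omega), hx2 a ha]
      · refine hx y ?_ i hi'
        intro a ha
        rw [hy' a (by omega), hx2 a (by omega), hx1 a ha]
  obtain ⟨x, hx⟩ := walk s le_rfl
  obtain ⟨x', hx', hx''⟩ := gap s le_rfl x
  obtain ⟨c, hc, hxc⟩ := hFcov x' trivial
  have hwalk := hx x' hx'
  by_cases hcC : c ∈ Cstage nrm p j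
  · have hcF' : c ∈ F' := Finset.mem_filter.2 ⟨hc, hcC⟩
    have hG : ∀ l ≤ s, c ∉ Gp l := by
      intro l hl hcl
      rcases hl.eq_or_lt with rfl | hl
      · exact hx'' c hcl x' (fun _ _ => rfl) hxc
      · exact (hwalk l hl).1 c hcl hxc
    have hcb : badB nrm g s N R v c := by
      intro l hl
      by_contra h
      exact hG l hl (Finset.mem_filter.2 ⟨hcF', not_lt.1 h⟩)
    have hcBd : c ∈ Bd := Finset.mem_filter.2 ⟨hcF', hcb⟩
    have hBs : ∀ l < s, R * nrm (c.2.1 ∩ Finset.Icc (g l v) (g l (v + 1))) < nrm c.2.1 := by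
      intro l hl
      by_contra h
      exact (hwalk l hl).2.1 c (Finset.mem_filter.2 ⟨hcBd, not_lt.1 h⟩) hxc
    have h1 := nrm_biUnion hn (Finset.range (s + 1) ×ˢ (Finset.univ : Finset Bool))
      (fun q => if q.2 then Finset.Icc (loB g v q.1) (hiB g s N v q.1) else
        if q.1 < s then Finset.Icc (g q.1 v) (g q.1 (v + 1)) else ∅) c.2.1 (by
        intro i hi
        rcases cov_gap g s N v i (hN c hc i hi) with ⟨l, hl, h⟩ | ⟨l, hl, h1, h2⟩
        · exact ⟨(l, true), by simp; omega, by simpa using h⟩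
        · refine ⟨(l, false), by simp; omega, ?_⟩
          simp only [Bool.false_eq_true, if_false, if_pos hl, Finset.mem_Icc]
          omega)
    have hpos : 0 < nrm c.2.1 := by
      have := hcb 0 (Nat.zero_le _); omega
    have h2 : R * nrm c.2.1 < R * nrm c.2.1 := by
      calc R * nrm c.2.1 ≤ _ := Nat.mul_le_mul_left _ h1
        _ = _ := by rw [Finset.mul_sum]
        _ < ∑ q ∈ (Finset.range (s + 1) ×ˢ (Finset.univ : Finset Bool)), nrm c.2.1 := by
            apply Finset.sum_lt_sum_of_nonempty
            · exact ⟨(0, true), by simp⟩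
            · rintro ⟨l, u⟩ hq
              simp only [Finset.mem_product, Finset.mem_range] at hq
              cases u
              · by_cases hl : l < s
                · simpa [hl] using hBs l hl
                · simpa [hl, hn.empty] using hpos
              · simpa using hcb l (by omega)
        _ = (2 * (s + 1)) * nrm c.2.1 := by
            rw [Finset.sum_const, Finset.card_product, Finset.card_range, _root_.smul_eq_mul, Finset.card_univ, Fintype.card_bool]; ring
        _ ≤ _ := Nat.mul_le_mul_right _ hR
    exact lt_irrefl _ h2
  · obtain ⟨l, hl, rfl⟩ := he c (Finset.mem_filter.2 ⟨hc, hcC⟩)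
    exact (hwalk l hl).2.2 hxc

lemma phi_univ {nrm : Finset ℕ → ℕ} (hn : IsAdmissibleNorm nrm) (p : ℕ) :
    ∀ j ≤ p, cK (p - j) ≤ phiE (Cstage nrm p j) Set.univ := by
  intro j
  induction j with
  | zero =>
    intro _
    by_contra h
    obtain ⟨F, hF, hcov, -⟩ := phiE_lt (not_le.1 h)
    obtain ⟨c, hc, -⟩ := hcov (fun _ => 0) trivial
    exact absurd (hF hc) (by simp [Cstage])
  | succ j ih =>
    intro hj
    have e : p - j = p - (j + 1) + 1 := by omega
    have := ih (by omega)
    rw [e] at this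
    exact main_step hn p j _ rfl e this

lemma four_pow (k : ℕ) : ((4 : ℕ) : ℝ≥0∞) ^ aK k ≤ 2 := by
  have h4 : ((4 : ℕ) : ℝ≥0∞) = 2 ^ (2 : ℝ) := by norm_num
  have h2 : (2 : ℝ≥0∞) = 2 ^ (1 : ℝ) := by norm_num
  rw [h4, ← ENNReal.rpow_mul]
  conv_rhs => rw [h2]
  apply ENNReal.rpow_le_rpow_of_exponent_le (by norm_num)
  unfold aK
  rw [mul_one_div, div_le_one (by positivity)]
  have : (0 : ℝ) ≤ k := by positivity
  have : (5 : ℝ) ^ 3 ≤ ((k : ℝ) + 5) ^ 3 := by gcongr; linarith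
  linarith

lemma split_mid {nrm : Finset ℕ → ℕ} (hn : IsAdmissibleNorm nrm) (I : Finset ℕ) (m N : ℕ)
    (hN : ∀ i ∈ I, i ≤ N) (hlow : ¬ nrm I ≤ 4 * nrm (I ∩ Finset.Icc 0 m)) :
    ∃ r, m < r ∧ nrm I ≤ 4 * nrm (I ∩ Finset.Icc m r) ∧ nrm I ≤ 4 * nrm (I ∩ Finset.Icc r N) := by
  have ex : ∃ r, nrm I ≤ 4 * nrm (I ∩ Finset.Icc m r) := by
    refine ⟨N, ?_⟩
    have h1 : nrm I ≤ nrm (I ∩ Finset.Icc 0 m) + nrm (I ∩ Finset.Icc m N) := by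
      refine (hn.mono _ _ ?_).trans (hn.subadd _ _)
      intro i hi
      have := hN i hi
      simp only [Finset.mem_union, Finset.mem_inter, Finset.mem_Icc]
      by_cases i ≤ m
      · left; exact ⟨hi, by omega⟩
      · right; exact ⟨hi, by omega⟩
    omega
  classical
  refine ⟨Nat.find ex, ?_, Nat.find_spec ex, ?_⟩
  · by_contra h
    have h1 := Nat.find_spec ex
    have h2 : nrm (I ∩ Finset.Icc m (Nat.find ex)) ≤ nrm (I ∩ Finset.Icc 0 m) := by
      apply hn.mono
      intro i
      simp only [Finset.mem_inter, Finset.mem_Icc]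
      rintro ⟨h1, h2⟩
      exact ⟨h1, by omega⟩
    omega
  · obtain ⟨r, hr⟩ : ∃ r, Nat.find ex = r := ⟨_, rfl⟩
    rw [hr]
    have h0 : ¬ (r = 0) → ¬ nrm I ≤ 4 * nrm (I ∩ Finset.Icc m (r - 1)) := fun h =>
      Nat.find_min ex (by omega)
    by_cases hr0 : r = 0
    · have : I ∩ Finset.Icc r N = I := by
        ext i
        simp only [Finset.mem_inter, Finset.mem_Icc]
        exact ⟨fun h => h.1, fun h => ⟨h, by omega, hN i h⟩⟩
      rw [this]; omega
    have h0 := h0 hr0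
    have h1 : nrm I ≤ nrm (I ∩ Finset.Icc 0 m) + (nrm (I ∩ Finset.Icc m (r - 1)) +
        nrm (I ∩ Finset.Icc r N)) := by
      refine (hn.mono _ _ ?_).trans ((hn.subadd _ _).trans (Nat.add_le_add_left (hn.subadd _ _) _))
      intro i hi
      have := hN i hi
      simp only [Finset.mem_union, Finset.mem_inter, Finset.mem_Icc]
      by_cases i ≤ m
      · left; exact ⟨hi, by omega⟩
      · right
        by_cases i ≤ r - 1
        · left; exact ⟨hi, by omega⟩
        · right; exact ⟨hi, by omega⟩
    omega

/-- Lemma 4.1: for all `k ≤ p`, the submeasure `ν_{k,p}` has the covering property. -/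
theorem nuKP_coveringProperty (nrm : Finset ℕ → ℕ) (hn : IsAdmissibleNorm nrm)
    (k p : ℕ) (hkp : k ≤ p) :
    CoveringProperty (nuKP nrm k p) := by
  classical
  intro m E hE hind hφ
  unfold nuKP Ckp at hφ ⊢
  have hpk : p - (p - k) = k := by omega
  have hT := phi_univ hn p (p - k) (by omega)
  rw [hpk] at hT
  obtain ⟨j0, hj0⟩ : ∃ j0, p - k = j0 := ⟨_, rfl⟩
  rw [hj0] at hφ hT hpk ⊢
  have hT' : 4 < phiE (Cstage nrm p j0) Set.univ :=
    lt_of_lt_of_le (by norm_num) ((le_cK k).trans hT)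
  obtain ⟨F, hFE, hFcov, hFw⟩ := phiE_lt hφ
  have hbound : ∀ G ⊆ F, ((4 : ℕ) : ℝ≥0∞) ^ aK (p - j0) * ∑ c ∈ G, c.2.2 ≤ 4 := by
    intro G hG
    calc _ ≤ 2 * 2 := mul_le_mul' (four_pow _) ((Finset.sum_le_sum_of_subset hG).trans hFw.le)
      _ = (4 : ℝ≥0∞) := by norm_num
  obtain ⟨N, hmN, hN⟩ : ∃ N, m ≤ N ∧ ∀ c ∈ F, ∀ i ∈ c.2.1, i ≤ N := by
    refine ⟨m + (F.biUnion fun c => c.2.1).sup id, by omega, fun c hc i hi => ?_⟩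
    have : i ≤ (F.biUnion fun c => c.2.1).sup id :=
      Finset.le_sup (f := id) (Finset.mem_biUnion.2 ⟨c, hc, hi⟩)
    omega
  let Low := F.filter fun c => nrm c.2.1 ≤ 4 * nrm (c.2.1 ∩ Finset.Icc 0 m)
  let Hi := F.filter fun c => ¬ nrm c.2.1 ≤ 4 * nrm (c.2.1 ∩ Finset.Icc 0 m)
  have hr : ∀ c : Set TT × Finset ℕ × ℝ≥0∞, ∃ r, c ∈ Hi → m < r ∧
      nrm c.2.1 ≤ 4 * nrm (c.2.1 ∩ Finset.Icc m r) ∧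
      nrm c.2.1 ≤ 4 * nrm (c.2.1 ∩ Finset.Icc r N) := by
    intro c
    by_cases hc : c ∈ Hi
    · obtain ⟨h1, h2⟩ := Finset.mem_filter.1 hc
      obtain ⟨r, hr⟩ := split_mid hn c.2.1 m N (hN c h1) h2
      exact ⟨r, fun _ => hr⟩
    · exact ⟨0, fun h => absurd h hc⟩
  choose rr hrr using hr
  obtain ⟨x0, -, hx0⟩ := avoid hn p 0 m 4 j0 (by norm_num) (Nat.zero_le _) (fun _ => 0) Low
    (fun c hc => hFE (Finset.mem_filter.1 hc).1) (fun c hc => (Finset.mem_filter.1 hc).2)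
    Set.univ ((hbound _ (Finset.filter_subset _ _)).trans_lt hT')
  obtain ⟨x, hx⟩ : ∃ x : TT, ∀ c ∈ Low, ∀ y ∈ cylSet m x, y ∉ c.1 := ⟨_, hx0⟩
  refine ⟨fun r => ⋃ c ∈ Hi.filter (fun c => rr c = r), clsn r (piMap m x ⁻¹' c.1), ?_, ?_, ?_⟩
  · intro r _ _ y z hyz
    simp only [Set.mem_iUnion]
    constructor
    · rintro ⟨c, hc, h⟩; exact ⟨c, hc, (memB_clsn r _ y z hyz).1 h⟩
    · rintro ⟨c, hc, h⟩; exact ⟨c, hc, (memB_clsn r _ y z hyz).2 h⟩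
  · intro j hmj _ y hy
    by_contra hcon
    simp only [Set.mem_iUnion, not_exists] at hcon
    obtain ⟨x', hx'⟩ : ∃ x', x' = piMap m x y := ⟨_, rfl⟩
    have hcyl : ∀ u ∈ cylSet j x', u ∈ E := by
      intro u hu
      refine (hind (piMap m y u) u ?_).1 (hy ?_)
      · intro i hi; simp [piMap, not_lt.2 hi]
      · intro i hi
        by_cases h : i < m
        · simp [piMap, h]
        · have := hu i hi
          simp only [piMap, hx', h, if_false] at this ⊢
          exact this
    have hsmall : ∀ c ∈ Hi, rr c ≤ j → ∀ u ∈ cylSet j x', u ∉ c.1 := by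
      intro c hc hcj u hu huc
      have hmr := (hrr c hc).1
      refine hcon (rr c) (Finset.mem_Ioc.2 ⟨hmr, hcj⟩) c (Finset.mem_filter.2 ⟨hc, rfl⟩) ?_
      refine ⟨piMap m y u, ?_, ?_⟩
      · have : piMap m x (piMap m y u) = u := by
          funext i
          by_cases h : i < m
          · have := hu i (by omega)
            simp only [piMap, hx', h, if_true] at this ⊢
            exact this.symm
          · simp [piMap, h]
        simp only [Set.mem_preimage, this]; exact huc
      · intro i hi
        by_cases h : i < m
        · simp [piMap, h]
        · have := hu i (by omega)
          simp only [piMap, hx', h, if_false] at this ⊢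
          exact this.symm
    obtain ⟨z, -, hz⟩ := avoid hn p j (max j N) 4 j0 (by norm_num) (le_max_left _ _) x'
      (Hi.filter fun c => j < rr c)
      (fun c hc => hFE (Finset.mem_filter.1 (Finset.mem_filter.1 hc).1).1)
      (fun c hc => by
        obtain ⟨h1, h2⟩ := Finset.mem_filter.1 hc
        refine (hrr c h1).2.2.trans (Nat.mul_le_mul_left _ (hn.mono _ _ ?_))
        intro i
        simp only [Finset.mem_inter, Finset.mem_Icc, le_max_iff]
        rintro ⟨h3, h4, h5⟩
        exact ⟨h3, by omega, Or.inr h5⟩)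
      Set.univ ((hbound _ ((Finset.filter_subset _ _).trans (Finset.filter_subset _ _))).trans_lt hT')
    have hu : piMap j x' z ∈ cylSet j x' := by
      intro i hi; simp [piMap, hi]
    obtain ⟨c, hc, huc⟩ := hFcov _ (hcyl _ hu)
    by_cases hlow : nrm c.2.1 ≤ 4 * nrm (c.2.1 ∩ Finset.Icc 0 m)
    · refine hx c (Finset.mem_filter.2 ⟨hc, hlow⟩) _ ?_ huc
      intro i hi
      rw [hu i (by omega), hx']
      simp [piMap, hi]
    · have hcH : c ∈ Hi := Finset.mem_filter.2 ⟨hc, hlow⟩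
      by_cases hcj : rr c ≤ j
      · exact hsmall c hcH hcj _ hu huc
      · exact hz c (Finset.mem_filter.2 ⟨hcH, not_le.1 hcj⟩) _ (fun _ _ => rfl) huc
  · calc _ ≤ ∑ r ∈ Finset.Ioc m (nOf E), ∑ c ∈ Hi.filter (fun c => rr c = r),
          ((4 : ℕ) : ℝ≥0∞) ^ aK (p - j0) * c.2.2 := by
          apply Finset.sum_le_sum
          intro r _
          refine phiE_le _ (fun c : Set TT × Finset ℕ × ℝ≥0∞ => (clsn r (piMap m x ⁻¹' c.1), c.2.1 ∩ Finset.Icc m r,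
            ((4 : ℕ) : ℝ≥0∞) ^ aK (p - j0) * c.2.2)) ?_ ?_
          · intro c hc
            obtain ⟨h1, rfl⟩ := Finset.mem_filter.1 hc
            exact cstage_transfer hn p m _ 4 (by norm_num) x j0 c
              (hFE (Finset.mem_filter.1 h1).1) (hrr c h1).2.1
          · intro y hy
            simpa using hy
      _ ≤ ∑ c ∈ Hi, ((4 : ℕ) : ℝ≥0∞) ^ aK (p - j0) * c.2.2 := by
          simp only [Finset.sum_filter]
          rw [Finset.sum_comm]
          rw [Finset.sum_filter]
          rw [← Finset.sum_filter]
          apply Finset.sum_le_sum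
          intro c _
          rw [Finset.sum_ite_eq]
          split_ifs <;> simp
      _ ≤ 4 := by
          rw [← Finset.mul_sum]
          exact hbound _ (Finset.filter_subset _ _)
end

section
/- For every countable ordinal γ there exists an exhaustive submeasure ν on the Boolean algebra ℬ of clopen subsets of T = ∏_{n∈ℕ} 2^n whose exhaustivity rank satisfies rk(ν) ≥ γ. -/
open Ordinal Filter
open scoped ENNReal
/-- `G` is a member of `D_ε(ν)` properly extending `F`: `G` is a finite set of pairwise
disjoint clopen sets of `ν`-submeasure `≥ ε`, and `G ⊋ F`. -/
def DRel (ν : Set TT → ℝ≥0∞) (ε : ℝ) (G F : Set (Set TT)) : Prop :=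
  (G.Finite ∧ (∀ a ∈ G, IsClopen a ∧ ENNReal.ofReal ε ≤ ν a) ∧ G.Pairwise Disjoint) ∧
    F ⊂ G

open Classical in
/-- `rk_ε(ν)`: the well-founded rank of `(D_ε(ν), ⊋)`, i.e. the rank of `∅`. -/
noncomputable def rkEps (ν : Set TT → ℝ≥0∞) (ε : ℝ) : Ordinal :=
  if h : WellFounded (DRel ν ε) then (h.apply (∅ : Set (Set TT))).rank else 0

/-- The exhaustivity rank `rk(ν) = sup_{ε > 0} rk_ε(ν)`. -/
noncomputable def rkSub (ν : Set TT → ℝ≥0∞) : Ordinal :=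
  ⨆ ε : {x : ℝ // 0 < x}, rkEps ν ε.1

/-- `ν` is exhaustive: along every pairwise disjoint sequence in `ℬ`, the submeasure
tends to `0`. -/
def Exhaustive (ν : Set TT → ℝ≥0∞) : Prop :=
  ∀ E : ℕ → Set TT, (∀ i, IsClopen (E i)) → (∀ i j, i ≠ j → Disjoint (E i) (E j)) →
    Filter.Tendsto (fun i => ν (E i)) Filter.atTop (nhds 0)

/-! ### Covers and thin sets -/

noncomputable def phi (E : Set (Set TT × ℝ≥0∞)) (X : Set TT) : ℝ≥0∞ :=
  ⨅ (F : Finset (Set TT × ℝ≥0∞)) (_ : ↑F ⊆ E) (_ : X ⊆ ⋃ c ∈ F, c.1), ∑ c ∈ F, c.2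

lemma phi_le_of_cover {E : Set (Set TT × ℝ≥0∞)} {X : Set TT} {ι : Type} (s : Finset ι)
    (Y : ι → Set TT) (w : ι → ℝ≥0∞) (hE : ∀ i ∈ s, (Y i, w i) ∈ E)
    (hX : ∀ x ∈ X, ∃ i ∈ s, x ∈ Y i) : phi E X ≤ ∑ i ∈ s, w i := by
  classical
  have h1 : phi E X ≤ ∑ c ∈ s.image (fun i => (Y i, w i)), c.2 := by
    refine iInf_le_of_le _ (iInf_le_of_le ?_ (iInf_le_of_le ?_ le_rfl))
    · intro c hc
      simp only [Finset.coe_image, Set.mem_image] at hc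
      obtain ⟨i, hi, rfl⟩ := hc
      exact hE i hi
    · intro x hx
      obtain ⟨i, hi, hxi⟩ := hX x hx
      simp only [Set.mem_iUnion]
      exact ⟨(Y i, w i), Finset.mem_image_of_mem _ hi, hxi⟩
  refine h1.trans ?_
  exact Finset.sum_image_le_of_nonneg (fun _ _ => zero_le)

lemma exists_cover_of_phi_lt {E : Set (Set TT × ℝ≥0∞)} {X : Set TT} {a : ℝ≥0∞}
    (h : phi E X < a) : ∃ F : Finset (Set TT × ℝ≥0∞), (∀ c ∈ F, c ∈ E) ∧
      (∀ x ∈ X, ∃ c ∈ F, x ∈ c.1) ∧ ∑ c ∈ F, c.2 < a := by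
  unfold phi at h
  simp only [iInf_lt_iff] at h
  obtain ⟨F, h1, h2, h3⟩ := h
  refine ⟨F, fun c hc => h1 hc, fun x hx => ?_, h3⟩
  have := h2 hx
  simpa using this

lemma phi_empty (E : Set (Set TT × ℝ≥0∞)) : phi E ∅ = 0 := by
  have := phi_le_of_cover (E := E) (X := ∅) (ι := ℕ) ∅ (fun _ => ∅) (fun _ => 0) (by simp) (by simp)
  simpa using this

lemma phi_mono {E : Set (Set TT × ℝ≥0∞)} {X Y : Set TT} (h : X ⊆ Y) : phi E X ≤ phi E Y := by
  refine le_of_forall_gt fun a ha => ?_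
  obtain ⟨F, h1, h2, h3⟩ := exists_cover_of_phi_lt ha
  exact (phi_le_of_cover F Prod.fst Prod.snd h1 (fun x hx => h2 x (h hx))).trans_lt h3

lemma phi_anti {E E' : Set (Set TT × ℝ≥0∞)} (h : E ⊆ E') (X : Set TT) : phi E' X ≤ phi E X := by
  refine le_of_forall_gt fun a ha => ?_
  obtain ⟨F, h1, h2, h3⟩ := exists_cover_of_phi_lt ha
  exact (phi_le_of_cover F Prod.fst Prod.snd (fun c hc => h (h1 c hc)) h2).trans_lt h3

lemma phi_union {E : Set (Set TT × ℝ≥0∞)} (X Y : Set TT) :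
    phi E (X ∪ Y) ≤ phi E X + phi E Y := by
  classical
  by_cases hX : phi E X = ⊤
  · simp [hX]
  by_cases hY : phi E Y = ⊤
  · simp [hY]
  refine ENNReal.le_of_forall_pos_le_add fun ε hε _ => ?_
  have he : (ε / 2 : NNReal) ≠ 0 := by positivity
  have he' : ((ε / 2 : NNReal) : ℝ≥0∞) ≠ 0 := by exact_mod_cast he
  obtain ⟨F, h1, h2, h3⟩ := exists_cover_of_phi_lt (ENNReal.lt_add_right hX he')
  obtain ⟨F', h1', h2', h3'⟩ := exists_cover_of_phi_lt (ENNReal.lt_add_right hY he')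
  have := phi_le_of_cover (E := E) (X := X ∪ Y) (F ∪ F') Prod.fst Prod.snd
    (fun c hc => by rcases Finset.mem_union.1 hc with h | h; exacts [h1 c h, h1' c h])
    (fun x hx => by
      rcases hx with h | h
      · obtain ⟨c, hc, hx⟩ := h2 x h
        exact ⟨c, Finset.mem_union_left _ hc, hx⟩
      · obtain ⟨c, hc, hx⟩ := h2' x h
        exact ⟨c, Finset.mem_union_right _ hc, hx⟩)
  have h4 : ∑ c ∈ F ∪ F', c.2 ≤ ∑ c ∈ F, c.2 + ∑ c ∈ F', c.2 := by
    rw [← Finset.sum_union_inter]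
    exact le_self_add
  calc phi E (X ∪ Y) ≤ ∑ c ∈ F, c.2 + ∑ c ∈ F', c.2 := this.trans h4
    _ ≤ (phi E X + (ε / 2 : NNReal)) + (phi E Y + (ε / 2 : NNReal)) := add_le_add h3.le h3'.le
    _ = phi E X + phi E Y + ((ε / 2 : NNReal) + (ε / 2 : NNReal)) := by ring
    _ = _ := by rw [← ENNReal.coe_add, add_halves]

lemma IsThin.mono {φ : Set TT → ℝ≥0∞} {m n n' : ℕ} {X X' : Set TT} (h : IsThin φ m n X)
    (hn : n ≤ n') (hX : X' ⊆ X) : IsThin φ m n' X' := by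
  intro x
  obtain ⟨H, h1, h2, h3⟩ := h x
  refine ⟨H, fun y z hyz => h1 y z fun i hi => hyz i (hi.trans_le hn), fun y hy => ?_, h3⟩
  exact ⟨(h2 hy).1, fun h => (h2 hy).2 (hX h)⟩

lemma IsThinOn.cls {φ : Set TT → ℝ≥0∞} {I J : Finset ℕ} {X : Set TT} (h : IsThinOn φ I X)
    (hJ : J ⊆ I) (n : ℕ) (hn : ∀ j ∈ J, j ≤ n) : IsThinOn φ J (clsn n X) := by
  intro i hi j hj hij x
  obtain ⟨H, h1, h2, h3⟩ := h i (hJ hi) j (hJ hj) hij x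
  refine ⟨H, h1, fun y hy => ⟨(h2 hy).1, ?_⟩, h3⟩
  rintro ⟨x', hx', hag⟩
  have : x' ∈ H := (h1 y x' fun i hi => hag i (hi.trans_le (hn j hj))).1 hy
  exact (h2 this).2 hx'

lemma IsThinOn.pi {φ : Set TT → ℝ≥0∞} {I J : Finset ℕ} {X : Set TT} (h : IsThinOn φ I X)
    (hJ : J ⊆ I) (m : ℕ) (x : TT) (hm : ∀ j ∈ J, m ≤ j) :
    IsThinOn φ J (piMap m x ⁻¹' X) := by
  intro i hi j hj hij x₁
  obtain ⟨H, h1, h2, h3⟩ := h i (hJ hi) j (hJ hj) hij (piMap m x x₁)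
  have hmi := hm i hi
  refine ⟨piMap m x ⁻¹' H ∩ cylSet i x₁, ?_, ?_, ?_⟩
  · intro y z hyz
    have e1 : y ∈ piMap m x ⁻¹' H ↔ z ∈ piMap m x ⁻¹' H := by
      refine h1 _ _ fun l hl => ?_
      simp only [piMap]
      split_ifs
      · rfl
      · exact hyz l hl
    have e2 : y ∈ cylSet i x₁ ↔ z ∈ cylSet i x₁ := by
      constructor
      · intro hy l hl
        rw [← hyz l (hl.trans hij)]; exact hy l hl
      · intro hy l hl
        rw [hyz l (hl.trans hij)]; exact hy l hl
    simp only [Set.mem_inter_iff, e1, e2]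
  · rintro y ⟨hy1, hy2⟩
    exact ⟨hy2, (h2 hy1).2⟩
  · refine h3.trans_eq (congrArg φ ?_)
    ext z
    have e : piMap m x (piMap i x₁ z) = piMap i (piMap m x x₁) z := by
      funext l
      simp only [piMap]
      split_ifs <;> first | rfl | omega
    simp only [Set.mem_preimage, Set.mem_inter_iff, e]
    refine ⟨fun h => ⟨h, fun l hl => by simp [piMap, hl]⟩, fun h => h.1⟩

/-! ### The construction -/

def NN (k : ℕ) : ℕ := 2 ^ (k + 5) + 1
def LL (k : ℕ) : ℕ := 2 * NN k + 1
def RR (k : ℕ) : ℕ := 8 * LL k ^ (2 ^ (k + 4))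

noncomputable def WW (k n : ℕ) : ℝ≥0∞ := (2⁻¹ : ℝ≥0∞) ^ k * 2 ^ (k + 5 - Nat.log (RR k) n)

def EE (nrm : Finset ℕ → ℕ) (φ : Set TT → ℝ≥0∞) (k : ℕ) : Set (Set TT × ℝ≥0∞) :=
  {c | ∃ I : Finset ℕ, IsThinOn φ I c.1 ∧ WW k (nrm I) ≤ c.2}

noncomputable def CC (nrm : Finset ℕ → ℕ) : ℕ → ℕ → Set (Set TT × ℝ≥0∞)
  | 0, _ => ∅
  | j + 1, k => CC nrm j (k + 1) ∪ EE nrm (phi (CC nrm j (k + 1))) k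

noncomputable def nuP (nrm : Finset ℕ → ℕ) (k p : ℕ) : Set TT → ℝ≥0∞ := phi (CC nrm (p - k) k)

lemma mem_CC_aux {nrm : Finset ℕ → ℕ} {c : Set TT × ℝ≥0∞} (p : ℕ) : ∀ (j k : ℕ), p = k + j →
    (c ∈ CC nrm j k ↔ ∃ l, k ≤ l ∧ l < p ∧ c ∈ EE nrm (nuP nrm (l + 1) p) l) := by
  intro j
  induction j with
  | zero =>
    intro k hk
    simp only [CC, Set.mem_empty_iff_false, false_iff]
    rintro ⟨l, h1, h2, -⟩
    omega
  | succ j ih =>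
    intro k hk
    have e : p - (k + 1) = j := by omega
    rw [CC, Set.mem_union, ih (k + 1) (by omega)]
    constructor
    · rintro (⟨l, h1, h2, h3⟩ | h)
      · exact ⟨l, by omega, h2, h3⟩
      · refine ⟨k, le_rfl, by omega, ?_⟩
        rw [nuP, e]; exact h
    · rintro ⟨l, h1, h2, h3⟩
      rcases h1.eq_or_lt with rfl | h1
      · right
        rw [nuP, e] at h3; exact h3
      · exact Or.inl ⟨l, h1, h2, h3⟩

lemma mem_CC {nrm : Finset ℕ → ℕ} {c : Set TT × ℝ≥0∞} (k p : ℕ) :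
    c ∈ CC nrm (p - k) k ↔ ∃ l, k ≤ l ∧ l < p ∧ c ∈ EE nrm (nuP nrm (l + 1) p) l := by
  rcases le_or_gt k p with h | h
  · exact mem_CC_aux p (p - k) k (by omega)
  · have e : p - k = 0 := by omega
    rw [e]
    simp only [CC, Set.mem_empty_iff_false, false_iff]
    rintro ⟨l, h1, h2, -⟩
    omega

lemma nuP_mono_level {nrm : Finset ℕ → ℕ} {k k' : ℕ} (h : k ≤ k') (p : ℕ) (X : Set TT) :
    nuP nrm k p X ≤ nuP nrm k' p X := by
  refine phi_anti ?_ X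
  intro c hc
  rw [mem_CC] at hc ⊢
  obtain ⟨l, h1, h2, h3⟩ := hc
  exact ⟨l, h.trans h1, h2, h3⟩

lemma LL_pos (k : ℕ) : 0 < LL k := by unfold LL; omega

lemma LL_mono {k k' : ℕ} (h : k ≤ k') : LL k ≤ LL k' := by
  unfold LL NN
  have := Nat.pow_le_pow_right (n := 2) (by norm_num) (Nat.add_le_add_right h 5)
  omega

lemma LL_le_RR (k : ℕ) : 8 * LL k ≤ RR k := by
  unfold RR
  have : LL k ≤ LL k ^ (2 ^ (k + 4)) := Nat.le_self_pow (by positivity) _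
  omega

lemma eight_le_RR (k : ℕ) : 8 ≤ RR k := by
  have := LL_le_RR k; have := LL_pos k; omega

lemma WW_ge (k n : ℕ) : (2⁻¹ : ℝ≥0∞) ^ k ≤ WW k n := by
  unfold WW
  refine le_mul_of_one_le_right (zero_le) ?_
  exact one_le_pow₀ (by norm_num)

lemma WW_anti (k : ℕ) {n n' : ℕ} (h : n ≤ n') : WW k n' ≤ WW k n := by
  unfold WW
  gcongr
  · norm_num

lemma WW_double (k : ℕ) {n n' : ℕ} (h : n ≤ RR k * n') : WW k n' ≤ 2 * WW k n := by
  unfold WW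
  have hR := eight_le_RR k
  have : Nat.log (RR k) n ≤ Nat.log (RR k) n' + 1 := by
    rcases Nat.eq_zero_or_pos n' with rfl | hn'
    · have : n = 0 := by simpa using h
      simp [this]
    · calc Nat.log (RR k) n ≤ Nat.log (RR k) (n' * RR k) := Nat.log_mono_right (by linarith [mul_comm (RR k) n'])
        _ = _ := Nat.log_mul_base (by omega) (by omega)
  calc (2⁻¹ : ℝ≥0∞) ^ k * 2 ^ (k + 5 - Nat.log (RR k) n')
      ≤ (2⁻¹ : ℝ≥0∞) ^ k * 2 ^ (k + 5 - Nat.log (RR k) n + 1) := by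
        gcongr
        · norm_num
        · omega
    _ = _ := by rw [pow_succ]; ring

lemma WW_small (k : ℕ) : ∃ M, ∀ n, M ≤ n → WW k n ≤ (2⁻¹ : ℝ≥0∞) ^ k := by
  refine ⟨RR k ^ (k + 5), fun n hn => ?_⟩
  have hR := eight_le_RR k
  have : k + 5 ≤ Nat.log (RR k) n := by
    calc k + 5 = Nat.log (RR k) (RR k ^ (k + 5)) := (Nat.log_pow (by omega) _).symm
      _ ≤ _ := Nat.log_mono_right hn
  unfold WW
  rw [Nat.sub_eq_zero_of_le this]; simp

lemma WW_big (k n : ℕ) (h : WW k n < 16) : RR k * RR k ≤ n := by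
  have hR := eight_le_RR k
  by_contra hlt
  have hlog : Nat.log (RR k) n ≤ 1 := by
    by_contra h2
    have h2 : 2 ≤ Nat.log (RR k) n := by omega
    have hn : n ≠ 0 := by rintro rfl; simp at h2
    have := Nat.pow_le_of_le_log hn h2
    rw [pow_two] at this
    exact hlt this
  have : (16 : ℝ≥0∞) ≤ WW k n := by
    unfold WW
    calc (16 : ℝ≥0∞) = (2⁻¹ : ℝ≥0∞) ^ k * 2 ^ (k + 4) := by
          rw [pow_add, ← mul_assoc, ← mul_pow, ENNReal.inv_mul_cancel (by norm_num) (by norm_num)]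
          norm_num
      _ ≤ _ := by
          gcongr
          · norm_num
          · omega
  exact absurd h (not_lt.2 this)
/-! ### The main estimate -/

structure NormP (nrm : Finset ℕ → ℕ) : Prop where
  mono : ∀ I J, I ⊆ J → nrm I ≤ nrm J
  add : ∀ I J, nrm (I ∪ J) ≤ nrm I + nrm J
  card : ∀ I : Finset ℕ, nrm I ≤ I.card

def Thin0 (m n : ℕ) (Y : Set TT) : Prop :=
  ∀ x : TT, ∃ y ∈ cylSet m x, ∀ z ∈ cylSet n y, z ∉ Y

lemma NormP.fiber {nrm : Finset ℕ → ℕ} (hn : NormP nrm) (P : Finset ℕ) (key : ℕ → ℕ) (L : ℕ)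
    (hL : 0 < L) (hkey : ∀ x, key x < L) :
    ∃ v, nrm P ≤ L * nrm (P.filter fun x => key x = v) := by
  have h1 : ∀ l, nrm (P.filter fun x => key x < l) ≤
      ∑ v ∈ Finset.range l, nrm (P.filter fun x => key x = v) := by
    intro l
    induction l with
    | zero => simpa using hn.card ∅
    | succ l ih =>
      have e : (P.filter fun x => key x < l + 1) =
          (P.filter fun x => key x < l) ∪ (P.filter fun x => key x = l) := by
        ext x; simp only [Finset.mem_filter, Finset.mem_union, ← and_or_left]
        have : key x < l + 1 ↔ key x < l ∨ key x = l := by omega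
        rw [this]
      rw [e, Finset.sum_range_succ]
      exact (hn.add _ _).trans (Nat.add_le_add_right ih _)
  have h2 : nrm P ≤ ∑ v ∈ Finset.range L, nrm (P.filter fun x => key x = v) := by
    refine le_trans (le_of_eq ?_) (h1 L)
    rw [Finset.filter_true_of_mem fun x _ => hkey x]
  have h3 : ∑ _v ∈ Finset.range L, nrm P ≤
      ∑ v ∈ Finset.range L, L * nrm (P.filter fun x => key x = v) := by
    rw [Finset.sum_const, Finset.card_range, _root_.smul_eq_mul, ← Finset.mul_sum]
    exact Nat.mul_le_mul_left _ h2
  obtain ⟨v, _, hv⟩ := Finset.exists_le_of_sum_le (Finset.nonempty_range_iff.2 hL.ne') h3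
  exact ⟨v, hv⟩

lemma thin_step {nrm : Finset ℕ → ℕ} {k p a n : ℕ} {X0 : Set TT}
    (h0 : IsThin (nuP nrm (k + 1) p) a n X0) {ι : Type} (g : Finset ι) (X : ι → Set TT)
    (w : ι → ℝ≥0∞) (lv : ι → ℕ) (I Q : ι → Finset ℕ)
    (hlv : ∀ t ∈ g, k < lv t ∧ lv t < p)
    (hth : ∀ t ∈ g, IsThinOn (nuP nrm (lv t + 1) p) (I t) (X t))
    (hQ : ∀ t ∈ g, Q t ⊆ I t) (hQ' : ∀ t ∈ g, ∀ q ∈ Q t, a ≤ q ∧ q ≤ n)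
    (hW : ∀ t ∈ g, WW (lv t) (nrm (Q t)) ≤ 2 * w t) (hsum : ∑ t ∈ g, 2 * w t ≤ 1) :
    Thin0 a n (X0 ∪ ⋃ t ∈ g, X t) := by
  intro x
  obtain ⟨H, h1, h2, h3⟩ := h0 x
  have h4 : ∃ z ∈ piMap a x ⁻¹' H, ∀ t ∈ g, z ∉ piMap a x ⁻¹' (clsn n (X t)) := by
    by_contra hcon
    push Not at hcon
    have := phi_le_of_cover (E := CC nrm (p - (k + 1)) (k + 1)) g
      (fun t => piMap a x ⁻¹' (clsn n (X t))) (fun t => 2 * w t)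
      (fun t ht => by
        rw [mem_CC]
        refine ⟨lv t, (hlv t ht).1, (hlv t ht).2, Q t, ?_, hW t ht⟩
        exact ((hth t ht).cls (hQ t ht) n (fun j hj => (hQ' t ht j hj).2)).pi
          (Finset.Subset.refl _) a x (fun j hj => (hQ' t ht j hj).1))
      hcon
    exact absurd (this.trans hsum) (not_le.2 h3)
  obtain ⟨z, hz, hz'⟩ := h4
  refine ⟨piMap a x z, (h2 hz).1, fun y hy hyX => ?_⟩
  have hyH : y ∈ H := (h1 _ _ hy).2 hz
  rcases hyX with hyX | hyX
  · exact (h2 hyH).2 hyX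
  · simp only [Set.mem_iUnion] at hyX
    obtain ⟨t, ht, hyt⟩ := hyX
    exact hz' t ht ⟨y, hyt, fun i hi => (hy i hi).symm⟩

lemma sel {nrm : Finset ℕ → ℕ} (hn : NormP nrm) (p : ℕ) (S : Finset ℕ) {ι : Type}
    [DecidableEq ι] (X : ι → Set TT)
    (w : ι → ℝ≥0∞) (lv : ι → ℕ) (I : ι → Finset ℕ) (B : ι → ℕ) :
    ∀ s : Finset ι, 
    (∀ t ∈ s, lv t < p) →
    (∀ t ∈ s, IsThinOn (nuP nrm (lv t + 1) p) (I t) (X t)) →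
    (∀ t ∈ s, (2⁻¹ : ℝ≥0∞) ^ (lv t) ≤ w t) →
    (∀ t ∈ s, ∀ n, B t ≤ n → WW (lv t) n ≤ 2 * w t) →
    (∀ t ∈ s, NN (lv t) + 1 ≤ B t) →
    (∑ t ∈ s, w t < 16) →
    ∀ P : ι → Finset ℕ, (∀ t ∈ s, P t ⊆ I t) →
    (∀ t ∈ s, B t * LL (lv t) ^ (s.filter fun t' => lv t' ≤ lv t).card ≤ nrm (P t)) →
    (∀ t ∈ s, ∀ a ∈ P t, ∃ n ∈ I t, a < n ∧ (∀ b ∈ P t, a < b → n ≤ b) ∧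
      (∀ u ∈ S, a ≤ u → n ≤ u)) →
    ∃ J : Finset (ℕ × ℕ × Set TT),
      (∀ j ∈ J, j.1 < j.2.1 ∧ Thin0 j.1 j.2.1 j.2.2 ∧ (∀ u ∈ S, j.1 ≤ u → j.2.1 ≤ u) ∧
        ∃ t ∈ s, j.1 ∈ P t ∧ ∃ b ∈ P t, j.2.1 ≤ b) ∧
      (∀ j ∈ J, ∀ j' ∈ J, j ≠ j' → j.2.1 ≤ j'.1 ∨ j'.2.1 ≤ j.1) ∧
      ∀ t ∈ s, ∃ j ∈ J, X t ⊆ j.2.2 := by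
  classical
  intro s
  induction s using Finset.strongInduction with
  | H s ih =>
  intro hlv hth hw hW hB hsum P hPI hP hnx
  rcases s.eq_empty_or_nonempty with rfl | hne
  · exact ⟨∅, by simp, by simp, by simp⟩
  obtain ⟨t0, ht0, hmin⟩ := s.exists_min_image lv hne
  set k := lv t0 with hk
  have hPcard : NN k + 1 ≤ (P t0).card := by
    refine le_trans ?_ (hn.card _)
    refine le_trans ?_ (hP t0 ht0)
    exact (hB t0 ht0).trans (Nat.le_mul_of_pos_right _ (pow_pos (LL_pos _) _))
  have hPne : (P t0).Nonempty := Finset.card_pos.1 (by omega)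
  obtain ⟨Q, hQsub, hQcard⟩ : ∃ Q ⊆ (P t0).erase ((P t0).max' hPne), Q.card = NN k := by
    apply Finset.exists_subset_card_eq
    rw [Finset.card_erase_of_mem (Finset.max'_mem _ _)]
    omega
  have hQP : ∀ a ∈ Q, a ∈ P t0 := fun a ha => Finset.mem_of_mem_erase (hQsub ha)
  have hQmax : ∀ a ∈ Q, ∃ b ∈ P t0, a < b := fun a ha =>
    ⟨_, Finset.max'_mem _ hPne, lt_of_le_of_ne (Finset.le_max' _ _ (hQP a ha))
      (Finset.ne_of_mem_erase (hQsub ha))⟩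
  have hex : ∀ a, ∃ n, a ∈ Q → (n ∈ I t0 ∧ a < n ∧ (∀ b ∈ P t0, a < b → n ≤ b) ∧
      (∀ u ∈ S, a ≤ u → n ≤ u)) := by
    intro a
    by_cases ha : a ∈ Q
    · obtain ⟨n, h⟩ := hnx t0 ht0 a (hQP a ha)
      exact ⟨n, fun _ => h⟩
    · exact ⟨0, fun h => absurd h ha⟩
  choose nx hnxQ using hex
  set C : Finset ℕ := Q ∪ Q.image nx with hC
  have hCcard : C.card ≤ 2 * NN k := by
    calc C.card ≤ Q.card + (Q.image nx).card := Finset.card_union_le _ _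
      _ ≤ Q.card + Q.card := Nat.add_le_add_left Finset.card_image_le _
      _ = _ := by rw [hQcard]; ring
  let key : ℕ → ℕ := fun x => (C.filter fun c => c ≤ x).card
  have hkeylt : ∀ x, key x < LL k := fun x => by
    have : key x ≤ C.card := Finset.card_filter_le _ _
    unfold LL; omega
  have hkey : ∀ x y, key x = key y → ∀ c ∈ C, c ≤ x → c ≤ y := by
    intro x y hxy c hc hcx
    by_contra hcy
    have hss : (C.filter fun c => c ≤ y) ⊂ (C.filter fun c => c ≤ x) := by
      rw [Finset.ssubset_iff_of_subset]
      · exact ⟨c, by simp [hc, hcx], by simp [hcy]⟩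
      · intro d hd
        rw [Finset.mem_filter] at hd ⊢
        exact ⟨hd.1, by omega⟩
    have := Finset.card_lt_card hss
    simp only [key] at hxy
    omega
  have hfib : ∀ t, ∃ v, nrm (P t) ≤ LL k * nrm ((P t).filter fun x => key x = v) :=
    fun t => hn.fiber (P t) key (LL k) (LL_pos k) hkeylt
  choose v hv using hfib
  let P' : ι → Finset ℕ := fun t => (P t).filter fun x => key x = v t
  have hP'sub : ∀ t, P' t ⊆ P t := fun t => Finset.filter_subset _ _
  have hP' : ∀ t ∈ s.erase t0, ∀ s' ⊆ s.erase t0,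
      B t * LL (lv t) ^ (s'.filter fun t' => lv t' ≤ lv t).card ≤ nrm (P' t) := by
    intro t ht s' hs'
    have hts := Finset.mem_of_mem_erase ht
    have hc : (s'.filter fun t' => lv t' ≤ lv t).card + 1 ≤
        (s.filter fun t' => lv t' ≤ lv t).card := by
      apply Nat.succ_le_of_lt
      apply Finset.card_lt_card
      rw [Finset.ssubset_iff_of_subset]
      · refine ⟨t0, by simpa [ht0] using hmin t hts, ?_⟩
        intro h
        have := hs' (Finset.mem_filter.1 h).1
        simp at this
      · intro d hd
        rw [Finset.mem_filter] at hd ⊢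
        exact ⟨Finset.mem_of_mem_erase (hs' hd.1), hd.2⟩
    have h1 : B t * LL (lv t) ^ ((s'.filter fun t' => lv t' ≤ lv t).card + 1) ≤
        LL k * nrm (P' t) := by
      refine le_trans ?_ (hv t)
      refine le_trans ?_ (hP t hts)
      exact Nat.mul_le_mul_left _ (Nat.pow_le_pow_right (LL_pos _) hc)
    have h2 : LL k * nrm (P' t) ≤ LL (lv t) * nrm (P' t) :=
      Nat.mul_le_mul_right _ (LL_mono (hmin t hts))
    have h3 := h1.trans h2
    rw [pow_succ] at h3
    refine Nat.le_of_mul_le_mul_left ?_ (LL_pos (lv t))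
    calc _ = B t * (LL (lv t) ^ (s'.filter fun t' => lv t' ≤ lv t).card * LL (lv t)) := by ring
      _ ≤ _ := h3
  have hP'B : ∀ t ∈ s.erase t0, B t ≤ nrm (P' t) := by
    intro t ht
    simpa using hP' t ht ∅ (by simp)
  have hP'ne : ∀ t ∈ s.erase t0, (P' t).Nonempty := by
    intro t ht
    apply Finset.card_pos.1
    have := hn.card (P' t)
    have := hP'B t ht
    have := hB t (Finset.mem_of_mem_erase ht)
    omega
  let grp : ℕ → Finset ι := fun a => (s.erase t0).filter fun t => ∀ x ∈ P' t, a ≤ x ∧ x < nx a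
  have hdisj : (Q : Set ℕ).PairwiseDisjoint grp := by
    have key2 : ∀ a ∈ Q, ∀ b ∈ Q, a < b → ∀ t, t ∈ grp a → t ∈ grp b → False := by
      intro a ha b hb hab t hta htb
      simp only [grp, Finset.mem_filter] at hta htb
      obtain ⟨x, hx⟩ := hP'ne t hta.1
      have h1 := hta.2 x hx
      have h2 := htb.2 x hx
      have h3 := (hnxQ a ha).2.2.1 b (hQP b hb) hab
      omega
    intro a ha b hb hab
    rw [Function.onFun, Finset.disjoint_left]
    intro t hta htb
    rcases lt_or_gt_of_ne hab with h | h
    · exact key2 a ha b hb h t hta htb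
    · exact key2 b hb a ha h t htb hta
  obtain ⟨a, haQ, ha⟩ : ∃ a ∈ Q, ∑ t ∈ grp a, w t < (2⁻¹ : ℝ≥0∞) ^ (k + 1) := by
    by_contra hcon
    push Not at hcon
    have h1 : ∑ _a ∈ Q, (2⁻¹ : ℝ≥0∞) ^ (k + 1) ≤ ∑ a ∈ Q, ∑ t ∈ grp a, w t :=
      Finset.sum_le_sum hcon
    rw [← Finset.sum_biUnion hdisj, Finset.sum_const, hQcard, _root_.nsmul_eq_mul] at h1
    have h2 : ∑ t ∈ Q.biUnion grp, w t ≤ ∑ t ∈ s, w t := by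
      apply Finset.sum_le_sum_of_subset
      intro t ht
      rw [Finset.mem_biUnion] at ht
      obtain ⟨a, _, ht⟩ := ht
      exact Finset.mem_of_mem_erase (Finset.mem_filter.1 ht).1
    have h3 : (16 : ℝ≥0∞) ≤ (NN k : ℝ≥0∞) * (2⁻¹ : ℝ≥0∞) ^ (k + 1) := by
      calc (16 : ℝ≥0∞) = 2 ^ (k + 5) * (2⁻¹ : ℝ≥0∞) ^ (k + 1) := by
            rw [show k + 5 = (k + 1) + 4 by ring, pow_add, mul_right_comm, ← mul_pow,
              ENNReal.mul_inv_cancel (by norm_num) (by norm_num)]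
            norm_num
        _ ≤ _ := by
            gcongr
            unfold NN
            push_cast
            exact le_self_add
    exact absurd (h3.trans (h1.trans h2)) (not_le.2 hsum)
  obtain ⟨hnI, han, hnb, hnS⟩ := hnxQ a haQ
  set n := nx a with hndef
  have hgs : ∀ t ∈ grp a, t ∈ s := fun t ht => Finset.mem_of_mem_erase (Finset.mem_filter.1 ht).1
  have hglv : ∀ t ∈ grp a, k < lv t := by
    intro t ht
    by_contra hle
    have h1 : (2⁻¹ : ℝ≥0∞) ^ k ≤ w t := by
      refine le_trans ?_ (hw t (hgs t ht))
      exact pow_le_pow_of_le_one zero_le (by norm_num) (not_lt.1 hle)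
    have h2 : w t ≤ ∑ t ∈ grp a, w t := Finset.single_le_sum (fun _ _ => zero_le) ht
    have h3 : (2⁻¹ : ℝ≥0∞) ^ (k + 1) ≤ (2⁻¹ : ℝ≥0∞) ^ k :=
      pow_le_pow_of_le_one zero_le (by norm_num) (by omega)
    exact absurd ha (not_lt.2 (h3.trans (h1.trans h2)))
  have hthin : Thin0 a n (X t0 ∪ ⋃ t ∈ grp a, X t) := by
    refine thin_step (nrm := nrm) (k := k) (p := p)
      (hth t0 ht0 a (hPI t0 ht0 (hQP a haQ)) n hnI han) (grp a) X w lv I P'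
      (fun t ht => ⟨hglv t ht, hlv t (hgs t ht)⟩) (fun t ht => hth t (hgs t ht))
      (fun t ht => (hP'sub t).trans (hPI t (hgs t ht))) ?_ ?_ ?_
    · intro t ht q hq
      have := (Finset.mem_filter.1 ht).2 q hq
      exact ⟨this.1, this.2.le⟩
    · intro t ht
      exact hW t (hgs t ht) _ (hP'B t (Finset.mem_filter.1 ht).1)
    · rw [← Finset.mul_sum]
      calc 2 * ∑ t ∈ grp a, w t ≤ 2 * (2⁻¹ : ℝ≥0∞) ^ (k + 1) := by gcongr
        _ = (2⁻¹ : ℝ≥0∞) ^ k := by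
          rw [pow_succ, mul_comm, mul_assoc, ENNReal.inv_mul_cancel (by norm_num) (by norm_num), mul_one]
        _ ≤ 1 := pow_le_one₀ zero_le (by norm_num)
  -- recursion
  set s' := (s.erase t0) \ grp a with hs'
  have hs'e : s' ⊆ s.erase t0 := Finset.sdiff_subset
  have hs's : s' ⊆ s := hs'e.trans (Finset.erase_subset _ _)
  have hs'ss : s' ⊂ s := lt_of_le_of_lt hs'e (Finset.erase_ssubset ht0)
  obtain ⟨J, hJ1, hJ2, hJ3⟩ := ih s' hs'ss (fun t ht => hlv t (hs's ht))
    (fun t ht => hth t (hs's ht)) (fun t ht => hw t (hs's ht)) (fun t ht => hW t (hs's ht))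
    (fun t ht => hB t (hs's ht))
    (lt_of_le_of_lt (Finset.sum_le_sum_of_subset hs's) hsum) P'
    (fun t ht => (hP'sub t).trans (hPI t (hs's ht)))
    (fun t ht => hP' t (hs'e ht) s' hs'e)
    (fun t ht b hb => by
      obtain ⟨n, h1, h2, h3, h4⟩ := hnx t (hs's ht) b (hP'sub t hb)
      exact ⟨n, h1, h2, fun b' hb' => h3 b' (hP'sub t hb'), h4⟩)
  have hsep : ∀ j ∈ J, j.2.1 ≤ a ∨ n ≤ j.1 := by
    intro j hj
    obtain ⟨hj1, -, -, t, ht, hjt, b, hb, hjb⟩ := hJ1 j hj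
    have hkc : ∀ x ∈ P' t, ∀ y ∈ P' t, key x = key y := by
      intro x hx y hy
      rw [(Finset.mem_filter.1 hx).2, (Finset.mem_filter.1 hy).2]
    have hng : t ∉ grp a := (Finset.mem_sdiff.1 ht).2
    have haC : a ∈ C := Finset.mem_union_left _ haQ
    have hnC : n ∈ C := Finset.mem_union_right _ (Finset.mem_image_of_mem _ haQ)
    have : ∃ x ∈ P' t, ¬ (a ≤ x ∧ x < n) := by
      by_contra hcon
      push Not at hcon
      exact hng (Finset.mem_filter.2 ⟨hs'e ht, hcon⟩)
    obtain ⟨x, hx, hxn⟩ := this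
    rcases lt_or_ge x a with hxa | hxa
    · left
      refine hjb.trans (le_of_lt ?_)
      by_contra hcon
      have := hkey b x (hkc b hb x hx) a haC (not_lt.1 hcon)
      omega
    · right
      have hnx' : n ≤ x := by
        by_contra h
        exact hxn ⟨hxa, by omega⟩
      exact hkey x j.1 (hkc x hx _ hjt) n hnC hnx'
  refine ⟨insert (a, n, X t0 ∪ ⋃ t ∈ grp a, X t) J, ?_, ?_, ?_⟩
  · intro j hj
    rcases Finset.mem_insert.1 hj with rfl | hj
    · obtain ⟨b, hb, hab⟩ := hQmax a haQ
      exact ⟨han, hthin, hnS, t0, ht0, hQP a haQ, b, hb, hnb b hb hab⟩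
    · obtain ⟨h1, h2, h3, t, ht, h4, b, hb, h5⟩ := hJ1 j hj
      exact ⟨h1, h2, h3, t, hs's ht, hP'sub t h4, b, hP'sub t hb, h5⟩
  · intro j hj j' hj' hne
    rcases Finset.mem_insert.1 hj with rfl | hj <;> rcases Finset.mem_insert.1 hj' with rfl | hj'
    · exact absurd rfl hne
    · exact (hsep j' hj').symm
    · exact hsep j hj
    · exact hJ2 j hj j' hj' hne
  · intro t ht
    by_cases h0 : t = t0
    · subst h0
      exact ⟨_, Finset.mem_insert_self _ _, Set.subset_union_left⟩
    by_cases hg : t ∈ grp a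
    · refine ⟨_, Finset.mem_insert_self _ _, ?_⟩
      intro x hx
      right
      simp only [Set.mem_iUnion]
      exact ⟨t, hg, hx⟩
    · obtain ⟨j, hj, h⟩ := hJ3 t (Finset.mem_sdiff.2 ⟨Finset.mem_erase.2 ⟨h0, ht⟩, hg⟩)
      exact ⟨j, Finset.mem_insert_of_mem hj, h⟩

lemma exists_avoid (S : Finset ℕ) (d : TT) (J : Finset (ℕ × ℕ × Set TT))
    (h1 : ∀ j ∈ J, j.1 < j.2.1 ∧ Thin0 j.1 j.2.1 j.2.2 ∧ (∀ u ∈ S, j.1 ≤ u → j.2.1 ≤ u))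
    (h2 : ∀ j ∈ J, ∀ j' ∈ J, j ≠ j' → j.2.1 ≤ j'.1 ∨ j'.2.1 ≤ j.1) :
    ∃ z : TT, (∀ u ∈ S, z u = d u) ∧ ∀ j ∈ J, z ∉ j.2.2 := by
  have main : ∀ m : ℕ, ∃ z : TT, (∀ u ∈ S, z u = d u) ∧
      ∀ j ∈ J, j.2.1 ≤ m → ∀ y ∈ cylSet m z, y ∉ j.2.2 := by
    intro m
    induction m using Nat.strong_induction_on with
    | _ m ih =>
    by_cases hex : ∃ j ∈ J, j.2.1 = m
    · obtain ⟨j, hj, rfl⟩ := hex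
      obtain ⟨hlt, hth, hS⟩ := h1 j hj
      obtain ⟨z, hz, hzJ⟩ := ih j.1 hlt
      obtain ⟨y, hy, hyJ⟩ := hth z
      refine ⟨fun i => if i < j.2.1 then y i else d i, ?_, ?_⟩
      · intro u hu
        by_cases h : u < j.2.1
        · simp only [h, if_true]
          have : u < j.1 := by
            by_contra hc
            have := hS u hu (not_lt.1 hc)
            omega
          rw [hy u this, hz u hu]
        · simp [h]
      · intro j' hj' hle x hx
        have hxy : ∀ i < j.2.1, x i = y i := fun i hi => by
          have := hx i hi
          simpa [hi] using this
        by_cases he : j' = j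
        · subst he
          exact hyJ x hxy
        · have hle' : j'.2.1 ≤ j.1 := by
            rcases h2 j' hj' j hj he with h | h
            · exact h
            · have := (h1 j' hj').1
              omega
          refine hzJ j' hj' hle' x fun i hi => ?_
          rw [hxy i (hi.trans hlt), hy i hi]
    · rcases Nat.eq_zero_or_pos m with rfl | hm
      · refine ⟨d, fun _ _ => rfl, fun j hj hle => ?_⟩
        have := (h1 j hj).1
        omega
      · obtain ⟨z, hz, hzJ⟩ := ih (m - 1) (by omega)
        refine ⟨z, hz, fun j hj hle y hy => ?_⟩
        have : j.2.1 ≠ m := fun h => hex ⟨j, hj, h⟩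
        exact hzJ j hj (by omega) y fun i hi => hy i (by omega)
  obtain ⟨z, hz, hzJ⟩ := main (J.sup fun j => j.2.1)
  refine ⟨z, hz, fun j hj => hzJ j hj (Finset.le_sup (f := fun j => j.2.1) hj) z ?_⟩
  intro i _
  rfl

/-- `S` is small for the norm: removing the points of `I` directly before points of `S` costs little -/
def SmallFor (nrm : Finset ℕ → ℕ) (S : Finset ℕ) : Prop :=
  ∀ I : Finset ℕ, (∀ i ∈ I, ∃ u ∈ S, i ≤ u ∧ ∀ i' ∈ I, i < i' → u < i') → nrm I ≤ 1

lemma main_estimate {nrm : Finset ℕ → ℕ} (hn : NormP nrm) (k p : ℕ) (S : Finset ℕ)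
    (hS : SmallFor nrm S) (d : TT) : 16 ≤ nuP nrm k p {z | ∀ u ∈ S, z u = d u} := by
  classical
  by_contra hcon
  obtain ⟨F, hF1, hF2, hF3⟩ := exists_cover_of_phi_lt (not_le.1 hcon)
  have hF1' : ∀ c : Set TT × ℝ≥0∞, ∃ l : ℕ, ∃ I : Finset ℕ, c ∈ F →
      (l < p ∧ IsThinOn (nuP nrm (l + 1) p) I c.1 ∧ WW l (nrm I) ≤ c.2) := by
    intro c
    by_cases hc : c ∈ F
    · obtain ⟨l, h1, h2, I, h3, h4⟩ := (mem_CC k p).1 (hF1 c hc)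
      exact ⟨l, I, fun _ => ⟨h2, h3, h4⟩⟩
    · exact ⟨0, ∅, fun h => absurd h hc⟩
  choose lv I hF using hF1'
  let P : Set TT × ℝ≥0∞ → Finset ℕ := fun c => (I c).filter fun i => ∃ i' ∈ I c, i < i' ∧
    (∀ b ∈ I c, i < b → i' ≤ b) ∧ ∀ u ∈ S, i ≤ u → i' ≤ u
  have hPn : ∀ c, nrm (I c) ≤ nrm (P c) + 2 := by
    intro c
    rcases (I c).eq_empty_or_nonempty with h | hne
    · have := hn.card (I c)
      rw [h, Finset.card_empty] at this
      rw [h]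
      omega
    set M := (I c).max' hne with hM
    set K := (I c \ P c).erase M with hK
    have hsub : I c ⊆ (P c ∪ K) ∪ {M} := by
      intro i hi
      by_cases h1 : i ∈ P c
      · simp [h1]
      · by_cases h2 : i = M
        · simp [h2]
        · simp [K, h1, h2, hi]
    have hK1 : nrm K ≤ 1 := by
      apply hS
      intro i hi
      rw [Finset.mem_erase, Finset.mem_sdiff] at hi
      obtain ⟨hiM, hiI, hiP⟩ := hi
      have hlt : i < M := lt_of_le_of_ne (Finset.le_max' _ _ hiI) hiM
      have hne' : ((I c).filter fun b => i < b).Nonempty :=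
        ⟨M, Finset.mem_filter.2 ⟨Finset.max'_mem _ _, hlt⟩⟩
      have hmem := Finset.mem_filter.1 (Finset.min'_mem _ hne')
      set i' := ((I c).filter fun b => i < b).min' hne' with hi'
      have hi'min : ∀ b ∈ I c, i < b → i' ≤ b := fun b hb hib =>
        Finset.min'_le _ _ (Finset.mem_filter.2 ⟨hb, hib⟩)
      have : ∃ u ∈ S, i ≤ u ∧ u < i' := by
        by_contra hc
        push Not at hc
        exact hiP (Finset.mem_filter.2 ⟨hiI, i', hmem.1, hmem.2, hi'min, hc⟩)
      obtain ⟨u, hu, hiu, hui⟩ := this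
      refine ⟨u, hu, hiu, fun b hb hib => hui.trans_le (hi'min b ?_ hib)⟩
      exact (Finset.mem_sdiff.1 (Finset.mem_of_mem_erase hb)).1
    have h1 := hn.mono _ _ hsub
    have h2 := hn.add (P c ∪ K) {M}
    have h3 := hn.add (P c) K
    have h4 := hn.card {M}
    rw [Finset.card_singleton] at h4
    omega
  have hwlt : ∀ c ∈ F, c.2 < 16 := fun c hc =>
    lt_of_le_of_lt (Finset.single_le_sum (f := fun c : Set TT × ℝ≥0∞ => c.2)
      (fun _ _ => zero_le) hc) hF3
  have hw : ∀ c ∈ F, (2⁻¹ : ℝ≥0∞) ^ (lv c) ≤ c.2 := fun c hc =>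
    (WW_ge _ _).trans (hF c hc).2.2
  have hbig : ∀ c ∈ F, RR (lv c) * RR (lv c) ≤ nrm (I c) := fun c hc =>
    WW_big _ _ ((hF c hc).2.2.trans_lt (hwlt c hc))
  have hcnt : ∀ l : ℕ, (F.filter fun c => lv c ≤ l).card ≤ 2 ^ (l + 4) := by
    intro l
    by_contra hc
    push Not at hc
    have h1 : ∑ _c ∈ F.filter (fun c => lv c ≤ l), (2⁻¹ : ℝ≥0∞) ^ l ≤
        ∑ c ∈ F.filter (fun c => lv c ≤ l), c.2 := by
      apply Finset.sum_le_sum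
      intro c hc
      rw [Finset.mem_filter] at hc
      refine le_trans ?_ (hw c hc.1)
      exact pow_le_pow_of_le_one zero_le (by norm_num) hc.2
    have h2 : ∑ c ∈ F.filter (fun c => lv c ≤ l), c.2 ≤ ∑ c ∈ F, c.2 :=
      Finset.sum_le_sum_of_subset (Finset.filter_subset _ _)
    rw [Finset.sum_const, _root_.nsmul_eq_mul] at h1
    have h3 : (16 : ℝ≥0∞) ≤ ((F.filter fun c => lv c ≤ l).card : ℝ≥0∞) * (2⁻¹ : ℝ≥0∞) ^ l := by
      calc (16 : ℝ≥0∞) = ((2 ^ (l + 4) : ℕ) : ℝ≥0∞) * (2⁻¹ : ℝ≥0∞) ^ l := by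
            push_cast
            rw [pow_add, mul_right_comm, ← mul_pow,
              ENNReal.mul_inv_cancel (by norm_num) (by norm_num)]
            norm_num
        _ ≤ _ := by
            gcongr
    exact absurd (h3.trans (h1.trans h2)) (not_le.2 hF3)
  let B : Set TT × ℝ≥0∞ → ℕ := fun c => nrm (I c) / RR (lv c) + 1
  obtain ⟨J, hJ1, hJ2, hJ3⟩ := sel hn p S Prod.fst Prod.snd lv I B F (fun c hc => (hF c hc).1)
    (fun c hc => (hF c hc).2.1) hw
    (by
      intro c hc n hBn
      have h1 : nrm (I c) ≤ RR (lv c) * n := by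
        have h2 : nrm (I c) < RR (lv c) * B c := Nat.lt_mul_div_succ _ (by
          have := eight_le_RR (lv c); omega)
        exact h2.le.trans (Nat.mul_le_mul_left _ hBn)
      refine (WW_double _ h1).trans ?_
      gcongr
      exact (hF c hc).2.2)
    (by
      intro c hc
      have h1 : RR (lv c) ≤ nrm (I c) / RR (lv c) := by
        rw [Nat.le_div_iff_mul_le (by have := eight_le_RR (lv c); omega)]
        exact hbig c hc
      have h2 := LL_le_RR (lv c)
      have h3 : LL (lv c) = 2 * NN (lv c) + 1 := rfl
      simp only [B]
      omega)
    hF3 P (fun c _ => Finset.filter_subset _ _)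
    (by
      intro c hc
      have h1 : LL (lv c) ^ (F.filter fun t' => lv t' ≤ lv c).card ≤ LL (lv c) ^ (2 ^ (lv c + 4)) :=
        Nat.pow_le_pow_right (LL_pos _) (hcnt _)
      have h2 : RR (lv c) = 8 * LL (lv c) ^ (2 ^ (lv c + 4)) := rfl
      set A := LL (lv c) ^ (2 ^ (lv c + 4)) with hA
      have h3 : B c * LL (lv c) ^ (F.filter fun t' => lv t' ≤ lv c).card ≤ B c * A :=
        Nat.mul_le_mul_left _ h1
      refine h3.trans ?_
      have h4 : nrm (I c) / RR (lv c) * RR (lv c) ≤ nrm (I c) := Nat.div_mul_le_self _ _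
      have h5 := hbig c hc
      have h6 := eight_le_RR (lv c)
      have h7 := hPn c
      have h8 : B c * A = nrm (I c) / RR (lv c) * A + A := by simp only [B]; ring
      have h9 : 8 * (nrm (I c) / RR (lv c) * A) ≤ nrm (I c) := by
        refine le_trans (le_of_eq ?_) h4
        rw [h2]; ring
      have h10 : RR (lv c) ≤ RR (lv c) * RR (lv c) := Nat.le_mul_of_pos_left _ (by omega)
      rw [h8]
      omega)
    (by
      intro c hc a ha
      obtain ⟨haI, i', hi', h1, h2, h3⟩ := Finset.mem_filter.1 ha
      exact ⟨i', hi', h1, fun b hb => h2 b (Finset.mem_filter.1 hb).1, h3⟩)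
  obtain ⟨z, hz, hzJ⟩ := exists_avoid S d J
    (fun j hj => ⟨(hJ1 j hj).1, (hJ1 j hj).2.1, (hJ1 j hj).2.2.1⟩) hJ2
  obtain ⟨c, hc, hzc⟩ := hF2 z hz
  obtain ⟨j, hj, hjX⟩ := hJ3 c hc
  exact hzJ j hj (hjX hzc)

lemma Ufin {β : Type*} (U : Ultrafilter ℕ) (s : Set β) (hs : s.Finite) (f : ℕ → β)
    (h : ∀ p, f p ∈ s) : ∃ b ∈ s, ∀ᶠ p in (U : Filter ℕ), f p = b := by
  have := (Ultrafilter.eventually_exists_mem_iff (f := U) (P := fun b p => f p = b) hs).1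
    (Eventually.of_forall fun p => ⟨f p, h p, rfl⟩)
  exact this

noncomputable def UU : Ultrafilter ℕ := hyperfilter ℕ

lemma UU_atTop : (UU : Filter ℕ) ≤ atTop := Nat.hyperfilter_le_atTop

noncomputable def nu (nrm : Finset ℕ → ℕ) (k : ℕ) (X : Set TT) : ℝ≥0∞ :=
  (UU.map fun p => nuP nrm k p X).lim

lemma nu_tendsto (nrm : Finset ℕ → ℕ) (k : ℕ) (X : Set TT) :
    Tendsto (fun p => nuP nrm k p X) (UU : Filter ℕ) (nhds (nu nrm k X)) :=
  Ultrafilter.le_nhds_lim _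

lemma nu_le_of {nrm : Finset ℕ → ℕ} {k : ℕ} {X : Set TT} {a : ℝ≥0∞}
    (h : ∀ᶠ p in (UU : Filter ℕ), nuP nrm k p X ≤ a) : nu nrm k X ≤ a :=
  le_of_tendsto (nu_tendsto nrm k X) h

lemma le_nu_of {nrm : Finset ℕ → ℕ} {k : ℕ} {X : Set TT} {a : ℝ≥0∞}
    (h : ∀ p, a ≤ nuP nrm k p X) : a ≤ nu nrm k X :=
  ge_of_tendsto' (nu_tendsto nrm k X) h

lemma nu_lt_ev {nrm : Finset ℕ → ℕ} {k : ℕ} {X : Set TT} {a : ℝ≥0∞}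
    (h : nu nrm k X < a) : ∀ᶠ p in (UU : Filter ℕ), nuP nrm k p X < a :=
  (nu_tendsto nrm k X).eventually_lt_const h

lemma lt_nu_ev {nrm : Finset ℕ → ℕ} {k : ℕ} {X : Set TT} {a : ℝ≥0∞}
    (h : a < nu nrm k X) : ∀ᶠ p in (UU : Filter ℕ), a < nuP nrm k p X :=
  (nu_tendsto nrm k X).eventually_const_lt h

lemma nu_empty (nrm : Finset ℕ → ℕ) (k : ℕ) : nu nrm k ∅ = 0 := by
  refine le_antisymm (nu_le_of (Eventually.of_forall fun p => ?_)) zero_le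
  exact (phi_empty _).le

lemma nu_mono {nrm : Finset ℕ → ℕ} {k : ℕ} {X Y : Set TT} (h : X ⊆ Y) :
    nu nrm k X ≤ nu nrm k Y :=
  le_of_tendsto_of_tendsto' (nu_tendsto nrm k X) (nu_tendsto nrm k Y) fun _ => phi_mono h

lemma nu_union (nrm : Finset ℕ → ℕ) (k : ℕ) (X Y : Set TT) :
    nu nrm k (X ∪ Y) ≤ nu nrm k X + nu nrm k Y :=
  le_of_tendsto_of_tendsto' (nu_tendsto nrm k _)
    ((nu_tendsto nrm k X).add (nu_tendsto nrm k Y)) fun _ => phi_union X Y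

lemma nu_level {nrm : Finset ℕ → ℕ} {k k' : ℕ} (h : k ≤ k') (X : Set TT) :
    nu nrm k X ≤ nu nrm k' X :=
  le_of_tendsto_of_tendsto' (nu_tendsto nrm k X) (nu_tendsto nrm k' X)
    fun p => nuP_mono_level h p X

lemma nu_biUnion {nrm : Finset ℕ → ℕ} {k : ℕ} {ι : Type*} (s : Finset ι) (Y : ι → Set TT) :
    nu nrm k (⋃ i ∈ s, Y i) ≤ ∑ i ∈ s, nu nrm k (Y i) := by
  classical
  induction s using Finset.induction_on with
  | empty => simp [nu_empty]
  | insert a s ha ih =>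
    rw [Finset.sum_insert ha, Finset.set_biUnion_insert]
    exact (nu_union _ _ _ _).trans (by gcongr)

lemma SmallFor_empty {nrm : Finset ℕ → ℕ} (hn : NormP nrm) : SmallFor nrm ∅ := by
  intro I hI
  have : I = ∅ := by
    refine Finset.eq_empty_of_forall_notMem fun i hi => ?_
    obtain ⟨u, hu, -⟩ := hI i hi
    simp at hu
  subst this
  exact (hn.card ∅).trans (by simp)

lemma nuP_univ {nrm : Finset ℕ → ℕ} (hn : NormP nrm) (k p : ℕ) :
    16 ≤ nuP nrm k p Set.univ :=
  (main_estimate hn k p ∅ (SmallFor_empty hn) (fun _ => 0)).trans (phi_mono (Set.subset_univ _))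

lemma nu_univ {nrm : Finset ℕ → ℕ} (hn : NormP nrm) (k : ℕ) : 16 ≤ nu nrm k Set.univ :=
  le_nu_of fun p => nuP_univ hn k p

lemma exists_reps (m : ℕ) : ∃ R : Finset TT, ∀ x : TT, ∃ r ∈ R, ∀ i < m, r i = x i := by
  classical
  let f : ((i : Fin m) → Fin (2 ^ (i : ℕ))) → TT := fun g i => if h : i < m then g ⟨i, h⟩ else 0
  refine ⟨Finset.univ.image f, fun x => ⟨f fun i => x i, by simp, fun i hi => ?_⟩⟩
  simp [f, hi]

lemma finite_memB (n : ℕ) : {X : Set TT | memB n X}.Finite := by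
  obtain ⟨R, hR⟩ := exists_reps n
  refine Set.Finite.of_finite_image (f := fun X => X ∩ (R : Set TT)) ?_ ?_
  · refine (Set.Finite.finite_subsets R.finite_toSet).subset ?_
    rintro _ ⟨X, -, rfl⟩
    exact Set.inter_subset_right
  · intro X hX Y hY h
    ext x
    obtain ⟨r, hr, hag⟩ := hR x
    have h1 := hX r x hag
    have h2 := hY r x hag
    have h3 : r ∈ X ∩ (R : Set TT) ↔ r ∈ Y ∩ (R : Set TT) := by
      simp only at h; rw [h]
    simp only [Set.mem_inter_iff, Finset.mem_coe, hr, and_true] at h3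
    rw [← h1, ← h2, h3]

lemma memB.mono {n n' : ℕ} {X : Set TT} (h : memB n X) (hn : n ≤ n') : memB n' X :=
  fun x y hxy => h x y fun i hi => hxy i (hi.trans_le hn)

lemma R0 {nrm : Finset ℕ → ℕ} (hn : NormP nrm) (k p : ℕ) (A : Set TT)
    (hA : nuP nrm k p A < 2) :
    ∃ Cs : ℕ → Set TT, (∀ n, memB n (Cs n) ∧ nuP nrm k p (Cs n) ≤ 4) ∧
      ∀ N : ℕ → ℕ, Monotone N → ∃ β : ℕ → ℝ≥0∞, (∀ L, ∑ l ∈ Finset.range L, β l ≤ 2) ∧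
        ∀ l m x, m ≤ N l → ∀ G ⊆ A, memB (N (l + 1)) G →
          nuP nrm k p (piMap m x ⁻¹' (G \ Cs (N l))) ≤ 2 * β l := by
  classical
  obtain ⟨F, hF1, hF2, hF3⟩ := exists_cover_of_phi_lt hA
  have hF1' : ∀ c, ∃ l I, c ∈ F → k ≤ l ∧ l < p ∧ IsThinOn (nuP nrm (l + 1) p) I c.1 ∧
      WW l (nrm I) ≤ c.2 := by
    intro c
    by_cases hc : c ∈ F
    · obtain ⟨l, h1, h2, I, h3, h4⟩ := (mem_CC k p).1 (hF1 c hc)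
      exact ⟨l, I, fun _ => ⟨h1, h2, h3, h4⟩⟩
    · exact ⟨0, ∅, fun h => absurd h hc⟩
  choose lv I hI using hF1'
  -- general membership
  have hmem : ∀ c ∈ F, ∀ J Y, IsThinOn (nuP nrm (lv c + 1) p) J Y →
      nrm (I c) ≤ 4 * nrm J → (Y, 2 * c.2) ∈ CC nrm (p - k) k := by
    intro c hc J Y hY hJ
    obtain ⟨h1, h2, h3, h4⟩ := hI c hc
    refine (mem_CC k p).2 ⟨lv c, h1, h2, J, hY, ?_⟩
    have : nrm (I c) ≤ RR (lv c) * nrm J := by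
      have := eight_le_RR (lv c)
      nlinarith
    exact (WW_double _ this).trans (by simp only; gcongr)
  have hsum : ∀ s ⊆ F, ∑ c ∈ s, 2 * c.2 ≤ 4 := by
    intro s hs
    rw [← Finset.mul_sum]
    calc 2 * ∑ c ∈ s, c.2 ≤ 2 * 2 := by
          gcongr
          exact (Finset.sum_le_sum_of_subset hs).trans hF3.le
      _ = 4 := by norm_num
  let lft : ℕ → Finset (Set TT × ℝ≥0∞) := fun n =>
    F.filter fun c => nrm (I c) ≤ 2 * nrm ((I c).filter (· ≤ n))
  refine ⟨fun n => ⋃ c ∈ lft n, clsn n c.1, fun n => ⟨?_, ?_⟩, ?_⟩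
  · intro x y hxy
    simp only [Set.mem_iUnion]
    refine exists_congr fun c => exists_congr fun _ => memB_clsn n c.1 x y hxy
  · refine (phi_le_of_cover (lft n) (fun c => clsn n c.1) (fun c => 2 * c.2) ?_ ?_).trans
      (hsum _ (Finset.filter_subset _ _))
    · intro c hc
      obtain ⟨hc1, hc2⟩ := Finset.mem_filter.1 hc
      refine hmem c hc1 _ _ ((hI c hc1).2.2.1.cls (Finset.filter_subset (· ≤ n) _) n ?_) (by omega)
      intro j hj
      exact (Finset.mem_filter.1 hj).2
    · intro x hx
      simpa using hx
  · intro N hN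
    let bt : ℕ → Finset (Set TT × ℝ≥0∞) := fun l => F.filter fun c =>
      2 * nrm ((I c).filter (· ≤ N l)) < nrm (I c) ∧
      3 * nrm (I c) ≤ 4 * nrm ((I c).filter (· ≤ N (l + 1)))
    refine ⟨fun l => ∑ c ∈ bt l, c.2, fun L => ?_, ?_⟩
    · have hd : ∀ l l', l < l' → Disjoint (bt l) (bt l') := by
        intro l l' hll
        rw [Finset.disjoint_left]
        intro c hc hc'
        obtain ⟨-, h1, h2⟩ := Finset.mem_filter.1 hc
        obtain ⟨-, h3, h4⟩ := Finset.mem_filter.1 hc'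
        have := hn.mono ((I c).filter (· ≤ N (l + 1))) ((I c).filter (· ≤ N l')) (by
          intro j hj
          rw [Finset.mem_filter] at hj ⊢
          exact ⟨hj.1, hj.2.trans (hN hll)⟩)
        omega
      rw [← Finset.sum_biUnion]
      · refine (Finset.sum_le_sum_of_subset ?_).trans hF3.le
        intro c hc
        obtain ⟨l, -, hl⟩ := Finset.mem_biUnion.1 hc
        exact (Finset.mem_filter.1 hl).1
      · intro l _ l' _ hne
        rcases lt_or_gt_of_ne hne with h | h
        · exact hd _ _ h
        · exact (hd _ _ h).symm
    · intro l m x hm G hG hGB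
      have hNl : N l ≤ N (l + 1) := hN (Nat.le_succ l)
      rw [Finset.mul_sum]
      refine phi_le_of_cover (bt l) (fun c => piMap m x ⁻¹' (clsn (N (l + 1)) c.1))
        (fun c => 2 * c.2) ?_ ?_
      · intro c hc
        obtain ⟨hc1, hc2, hc3⟩ := Finset.mem_filter.1 hc
        let J := (I c).filter fun j => N l < j ∧ j ≤ N (l + 1)
        have hJ := (hI c hc1).2.2.1.cls (J := J) (Finset.filter_subset _ _) (N (l + 1))
          (fun j hj => (Finset.mem_filter.1 hj).2.2)
        refine hmem c hc1 J _ (hJ.pi (Finset.Subset.refl _) m x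
          (fun j hj => hm.trans (Finset.mem_filter.1 hj).2.1.le)) ?_
        have h1 := hn.mono ((I c).filter (· ≤ N (l + 1))) ((I c).filter (· ≤ N l) ∪ J) (by
          intro j hj
          rw [Finset.mem_filter] at hj
          rw [Finset.mem_union, Finset.mem_filter, Finset.mem_filter]
          rcases le_or_gt j (N l) with h | h
          · exact Or.inl ⟨hj.1, h⟩
          · exact Or.inr ⟨hj.1, h, hj.2⟩)
        have h2 := hn.add ((I c).filter (· ≤ N l)) J
        omega
      · intro z hz
        by_contra hno
        push Not at hno
        set y := piMap m x z with hy
        have hyG : y ∈ G := hz.1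
        have hyC : y ∉ ⋃ c ∈ lft (N l), clsn (N l) c.1 := hz.2
        simp only [Set.mem_iUnion, not_exists] at hyC
        let late := F.filter fun c => 4 * nrm ((I c).filter (· ≤ N (l + 1))) < 3 * nrm (I c)
        have hbad : nuP nrm k p Set.univ ≤ 4 := by
          refine (phi_le_of_cover late (fun c => piMap (N (l + 1)) y ⁻¹' c.1)
            (fun c => 2 * c.2) ?_ ?_).trans (hsum _ (Finset.filter_subset _ _))
          · intro c hc
            obtain ⟨hc1, hc2⟩ := Finset.mem_filter.1 hc
            let J := (I c).filter fun j => N (l + 1) < j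
            refine hmem c hc1 J _ ((hI c hc1).2.2.1.pi (J := J) (Finset.filter_subset _ _) _ y
              (fun j hj => (Finset.mem_filter.1 hj).2.le)) ?_
            have h1 := hn.mono (I c) ((I c).filter (· ≤ N (l + 1)) ∪ J) (by
              intro j hj
              rw [Finset.mem_union, Finset.mem_filter, Finset.mem_filter]
              rcases le_or_gt j (N (l + 1)) with h | h
              · exact Or.inl ⟨hj, h⟩
              · exact Or.inr ⟨hj, h⟩)
            have h2 := hn.add ((I c).filter (· ≤ N (l + 1))) J
            omega
          · intro v _
            have hag : ∀ i < N (l + 1), y i = piMap (N (l + 1)) y v i := by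
              intro i hi; simp [piMap, hi]
            have hvG : piMap (N (l + 1)) y v ∈ G := (hGB _ _ hag).1 hyG
            obtain ⟨c, hc, hvc⟩ := hF2 _ (hG hvG)
            refine ⟨c, Finset.mem_filter.2 ⟨hc, ?_⟩, hvc⟩
            by_contra hlate
            have hl : c ∉ lft (N l) := fun hcl =>
              hyC c hcl ⟨_, hvc, fun i hi => hag i (hi.trans_le hNl)⟩
            have hb : c ∉ bt l := fun hcb => hno c hcb ⟨_, hvc, hag⟩
            simp only [lft, Finset.mem_filter, hc, true_and, not_le] at hl
            simp only [bt, Finset.mem_filter, hc, true_and, not_and, not_le] at hb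
            exact hlate (hb hl)
        have := (nuP_univ hn k p).trans hbad
        norm_num at this

lemma lemR {nrm : Finset ℕ → ℕ} (hn : NormP nrm) (k m : ℕ) (G : ℕ → Set TT)
    (hG : ∀ i, ∃ n, memB n (G i)) (hG1 : ∀ r, nu nrm k (⋃ j ∈ Finset.range r, G j) ≤ 1)
    {ε : ℝ≥0∞} (hε : ε ≠ 0) :
    ∃ n, m ≤ n ∧ ∃ C, memB n C ∧ nu nrm k C ≤ 4 ∧
      ∀ i x, nu nrm k (piMap m x ⁻¹' (G i \ C)) ≤ ε := by
  classical
  have hCs : ∀ r p, ∃ Cs : ℕ → Set TT, (∀ n, memB n (Cs n)) ∧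
      (nuP nrm k p (⋃ j ∈ Finset.range r, G j) < 2 → (∀ n, nuP nrm k p (Cs n) ≤ 4) ∧
      ∀ N : ℕ → ℕ, Monotone N → ∃ β : ℕ → ℝ≥0∞, (∀ L, ∑ l ∈ Finset.range L, β l ≤ 2) ∧
        ∀ l m x, m ≤ N l → ∀ G' ⊆ (⋃ j ∈ Finset.range r, G j), memB (N (l + 1)) G' →
          nuP nrm k p (piMap m x ⁻¹' (G' \ Cs (N l))) ≤ 2 * β l) := by
    intro r p
    by_cases h : nuP nrm k p (⋃ j ∈ Finset.range r, G j) < 2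
    · obtain ⟨Cs, h1, h2⟩ := R0 hn k p _ h
      exact ⟨Cs, fun n => (h1 n).1, fun _ => ⟨fun n => (h1 n).2, h2⟩⟩
    · exact ⟨fun _ => ∅, fun n x y _ => by simp, fun h' => absurd h' h⟩
  choose Cs hCB hCs using hCs
  have hlt : ∀ r, ∀ᶠ p in (UU : Filter ℕ), nuP nrm k p (⋃ j ∈ Finset.range r, G j) < 2 :=
    fun r => nu_lt_ev ((hG1 r).trans_lt (by norm_num))
  have hC1 : ∀ n r, ∃ C, memB n C ∧ ∀ᶠ p in (UU : Filter ℕ), Cs r p n = C := fun n r =>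
    Ufin UU _ (finite_memB n) (fun p => Cs r p n) (fun p => hCB r p n)
  choose C1 hC1B hC1 using hC1
  have hC : ∀ n, ∃ C, memB n C ∧ ∀ᶠ r in (UU : Filter ℕ), C1 n r = C := fun n =>
    Ufin UU _ (finite_memB n) (fun r => C1 n r) (fun r => hC1B n r)
  choose C hCB' hC using hC
  have hC4 : ∀ n, nu nrm k (C n) ≤ 4 := by
    intro n
    obtain ⟨r, hr⟩ := (hC n).exists
    refine nu_le_of ?_
    filter_upwards [hlt r, hC1 n r] with p h1 h2
    rw [← hr, ← h2]
    exact (hCs r p h1).1 n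
  by_contra hcon
  have hbad : ∀ n, ∃ i x, m ≤ n → ε < nu nrm k (piMap m x ⁻¹' (G i \ C n)) := by
    intro n
    by_contra h
    push Not at h
    exact hcon ⟨n, (h 0 (fun _ => 0)).1, C n, hCB' n, hC4 n, fun i x => (h i x).2⟩
  choose i x hix using hbad
  choose Nn hNn using hG
  let N : ℕ → ℕ := fun l => Nat.rec m (fun _ q => max q (Nn (i q))) l
  have hNs : ∀ l, N (l + 1) = max (N l) (Nn (i (N l))) := fun l => rfl
  have hNm : Monotone N := monotone_nat_of_le_succ fun l => by rw [hNs]; exact le_max_left _ _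
  have hN0 : ∀ l, m ≤ N l := fun l => hNm (Nat.zero_le l)
  obtain ⟨L, hL⟩ := ENNReal.exists_nat_mul_gt hε (b := 4) (by norm_num)
  have hr : ∀ᶠ r in (UU : Filter ℕ), ∀ l ∈ Finset.range L, i (N l) < r ∧ C1 (N l) r = C (N l) := by
    rw [Filter.eventually_all_finset]
    intro l _
    exact ((eventually_gt_atTop (i (N l))).filter_mono UU_atTop).and (hC _)
  obtain ⟨r, hr⟩ := hr.exists
  have hp : ∀ᶠ p in (UU : Filter ℕ), ∀ l ∈ Finset.range L, Cs r p (N l) = C (N l) ∧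
      ε < nuP nrm k p (piMap m (x (N l)) ⁻¹' (G (i (N l)) \ C (N l))) := by
    rw [Filter.eventually_all_finset]
    intro l hl
    rw [← (hr l hl).2]
    refine (hC1 _ _).and ?_
    rw [(hr l hl).2]
    exact lt_nu_ev (hix _ (hN0 l))
  obtain ⟨p, hp, hp2⟩ := (hp.and (hlt r)).exists
  obtain ⟨β, hβ, hβ2⟩ := (hCs r p hp2).2 N hNm
  have h1 : ∀ l ∈ Finset.range L, ε ≤ 2 * β l := by
    intro l hl
    refine (hp l hl).2.le.trans ?_
    rw [← (hp l hl).1]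
    refine hβ2 l m _ (hN0 l) _ ?_ ?_
    · exact Set.subset_biUnion_of_mem (u := G) (Finset.mem_coe.2 (Finset.mem_range.2 (hr l hl).1))
    · exact (hNn _).mono (by rw [hNs]; exact le_max_right _ _)
  have h2 := Finset.sum_le_sum h1
  rw [Finset.sum_const, Finset.card_range, _root_.nsmul_eq_mul, ← Finset.mul_sum] at h2
  have h3 : (L : ℝ≥0∞) * ε ≤ 4 := h2.trans (by
    calc 2 * ∑ l ∈ Finset.range L, β l ≤ 2 * 2 := by gcongr; exact hβ L
      _ = 4 := by norm_num)
  exact absurd h3 (not_le.2 hL)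

lemma cylSet_congr {m : ℕ} {x x' : TT} (h : ∀ i < m, x' i = x i) : cylSet m x' = cylSet m x := by
  ext z
  refine forall_congr' fun i => forall_congr' fun hi => ?_
  rw [h i hi]

lemma piMap_congr {m : ℕ} {x x' : TT} (h : ∀ i < m, x' i = x i) : piMap m x' = piMap m x := by
  funext z i
  by_cases hi : i < m
  · simp [piMap, hi, h i hi]
  · simp [piMap, hi]

lemma div_card_sum {ι : Type*} (R : Finset ι) (ε : ℝ≥0∞) :
    ∑ _u ∈ R, ε / (R.card : ℝ≥0∞) ≤ ε := by
  rw [Finset.sum_const, _root_.nsmul_eq_mul]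
  exact ENNReal.mul_div_le

lemma atom_step {nrm : Finset ℕ → ℕ} (hn : NormP nrm) (E : ℕ → Set TT)
    (hE : ∀ i, ∃ n, memB n (E i)) (hd : ∀ i j, i ≠ j → Disjoint (E i) (E j)) (k m : ℕ)
    {ε : ℝ≥0∞} (hε : ε ≠ 0) (x : TT) :
    ∃ n i0, ∃ H, memB n H ∧ H ⊆ cylSet m x ∧ 1 < nu nrm k (piMap m x ⁻¹' H) ∧
      ∀ i, i0 ≤ i → nu nrm k (E i ∩ H) ≤ ε := by
  classical
  have hcyl : ∀ z, piMap m x z ∈ cylSet m x := by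
    intro z i hi
    simp [piMap, hi]
  by_cases hcase : ∃ r, 1 < nu nrm k (piMap m x ⁻¹' (⋃ j ∈ Finset.range r, E j))
  · obtain ⟨r, hr⟩ := hcase
    choose N hN using hE
    refine ⟨max m ((Finset.range r).sup N), r, cylSet m x ∩ ⋃ j ∈ Finset.range r, E j, ?_,
      Set.inter_subset_left, ?_, ?_⟩
    · intro y z hyz
      have h1 : y ∈ cylSet m x ↔ z ∈ cylSet m x := by
        refine forall_congr' fun i => forall_congr' fun hi => ?_
        rw [hyz i (hi.trans_le (le_max_left _ _))]
      have h2 : y ∈ (⋃ j ∈ Finset.range r, E j) ↔ z ∈ ⋃ j ∈ Finset.range r, E j := by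
        simp only [Set.mem_iUnion]
        refine exists_congr fun j => exists_congr fun hj => ?_
        exact ((hN j).mono ((Finset.le_sup (f := N) hj).trans (le_max_right _ _))) y z hyz
      rw [Set.mem_inter_iff, Set.mem_inter_iff, h1, h2]
    · refine hr.trans_le (nu_mono fun z hz => ⟨hcyl z, hz⟩)
    · intro i hi
      have : E i ∩ (cylSet m x ∩ ⋃ j ∈ Finset.range r, E j) = ∅ := by
        rw [Set.eq_empty_iff_forall_notMem]
        rintro z ⟨h1, -, h2⟩
        simp only [Set.mem_iUnion, Finset.mem_range] at h2
        obtain ⟨j, hj, h2⟩ := h2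
        exact Set.disjoint_left.1 (hd i j (by omega)) h1 h2
      rw [this, nu_empty]
      exact zero_le
  · push Not at hcase
    obtain ⟨R, hR⟩ := exists_reps m
    have hε' : ε / (R.card : ℝ≥0∞) ≠ 0 := (ENNReal.div_pos hε (ENNReal.natCast_ne_top _)).ne'
    obtain ⟨n, hmn, C, hCB, hC4, hCε⟩ := lemR hn k m (fun i => piMap m x ⁻¹' E i) (by
      intro i
      obtain ⟨n, h⟩ := hE i
      refine ⟨n, fun y z hyz => h _ _ fun j hj => ?_⟩
      simp only [piMap]
      split_ifs
      · rfl
      · exact hyz j hj) (by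
      intro r
      have := hcase r
      simpa only [Set.preimage_iUnion] using this) hε'
    refine ⟨n, 0, cylSet m x ∩ {z | ∃ y, y ∉ C ∧ ∀ i, m ≤ i → y i = z i}, ?_,
      Set.inter_subset_left, ?_, ?_⟩
    · have key : ∀ z z' : TT, (∀ i < n, z i = z' i) →
          z ∈ cylSet m x ∩ {z | ∃ y, y ∉ C ∧ ∀ i, m ≤ i → y i = z i} →
          z' ∈ cylSet m x ∩ {z | ∃ y, y ∉ C ∧ ∀ i, m ≤ i → y i = z i} := by
        rintro z z' hzz ⟨h1, y, hy, hyz⟩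
        refine ⟨fun i hi => (hzz i (hi.trans_le hmn)).symm.trans (h1 i hi),
          fun i => if i < n then y i else z' i, ?_, ?_⟩
        · intro hC
          exact hy ((hCB _ y (fun i hi => by simp [hi])).1 hC)
        · intro i hi
          by_cases hin : i < n
          · simp only [hin, if_true]
            rw [hyz i hi, hzz i hin]
          · simp [hin]
      intro z z' hzz
      exact ⟨key z z' hzz, key z' z fun i hi => (hzz i hi).symm⟩
    · have h1 : nu nrm k Cᶜ ≤ nu nrm k (piMap m x ⁻¹'
          (cylSet m x ∩ {z | ∃ y, y ∉ C ∧ ∀ i, m ≤ i → y i = z i})) := by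
        refine nu_mono fun y hy => ⟨hcyl y, y, hy, fun i hi => ?_⟩
        simp [piMap, not_lt.2 hi]
      refine lt_of_lt_of_le ?_ h1
      by_contra hle
      have h2 := (nu_univ hn k).trans ((nu_mono (by rw [Set.union_compl_self])).trans
        (nu_union nrm k C Cᶜ))
      have h3 := h2.trans (add_le_add hC4 (not_lt.1 hle))
      norm_num at h3
    · intro i _
      refine (nu_mono (Y := ⋃ u ∈ R, piMap m u ⁻¹' (piMap m x ⁻¹' E i \ C)) ?_).trans
        ((nu_biUnion _ _).trans ((Finset.sum_le_sum fun u _ => hCε i u).trans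
          (div_card_sum R ε)))
      rintro z ⟨hz, hzx, y, hy, hyz⟩
      obtain ⟨u, hu, hag⟩ := hR y
      have e1 : piMap m u z = y := by
        funext j
        by_cases hj : j < m
        · simp [piMap, hj, hag j hj]
        · simp [piMap, hj, hyz j (not_lt.1 hj)]
      have e2 : piMap m x y = z := by
        funext j
        by_cases hj : j < m
        · simp [piMap, hj, hzx j hj]
        · simp [piMap, hj, hyz j (not_lt.1 hj)]
      simp only [Set.mem_iUnion]
      refine ⟨u, hu, ?_⟩
      rw [Set.mem_preimage, e1]
      refine ⟨?_, hy⟩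
      rw [Set.mem_preimage, e2]
      exact hz

lemma step_lemma {nrm : Finset ℕ → ℕ} (hn : NormP nrm) (E : ℕ → Set TT)
    (hE : ∀ i, ∃ n, memB n (E i)) (hd : ∀ i j, i ≠ j → Disjoint (E i) (E j)) (k m : ℕ)
    {ε : ℝ≥0∞} (hε : ε ≠ 0) :
    ∃ n, m < n ∧ ∃ i0, ∀ i, i0 ≤ i → ∃ Z, nu nrm k Z ≤ ε ∧ IsThin (nu nrm k) m n (E i \ Z) := by
  classical
  obtain ⟨R, hR⟩ := exists_reps m
  have hε' : ε / (R.card : ℝ≥0∞) ≠ 0 := (ENNReal.div_pos hε (ENNReal.natCast_ne_top _)).ne'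
  choose n i0 H h1 h2 h3 h4 using fun x => atom_step hn E hE hd k m hε' x
  refine ⟨max (m + 1) (R.sup n), lt_of_lt_of_le (Nat.lt_succ_self m) (le_max_left _ _),
    R.sup i0, fun i hi => ⟨⋃ x ∈ R, E i ∩ H x, ?_, ?_⟩⟩
  · exact (nu_biUnion _ _).trans ((Finset.sum_le_sum fun u hu =>
      h4 u i ((Finset.le_sup (f := i0) hu).trans hi)).trans (div_card_sum R ε))
  · intro x
    obtain ⟨r, hr, hag⟩ := hR x
    refine ⟨H r, (h1 r).mono ((Finset.le_sup (f := n) hr).trans (le_max_right _ _)), ?_, ?_⟩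
    · intro z hz
      refine ⟨?_, fun hz' => hz'.2 ?_⟩
      · rw [← cylSet_congr hag]
        exact h2 r hz
      · simp only [Set.mem_iUnion]
        exact ⟨r, hr, hz'.1, hz⟩
    · rw [← piMap_congr hag]
      exact h3 r

lemma thin_ev {nrm : Finset ℕ → ℕ} {k m n : ℕ} {X : Set TT} (h : IsThin (nu nrm k) m n X) :
    ∀ᶠ p in (UU : Filter ℕ), IsThin (nuP nrm k p) m n X := by
  obtain ⟨R, hR⟩ := exists_reps m
  choose H h1 h2 h3 using h
  have : ∀ᶠ p in (UU : Filter ℕ), ∀ r ∈ R, 1 < nuP nrm k p (piMap m r ⁻¹' H r) := by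
    rw [Filter.eventually_all_finset]
    intro r _
    exact lt_nu_ev (h3 r)
  filter_upwards [this] with p hp x
  obtain ⟨r, hr, hag⟩ := hR x
  refine ⟨H r, h1 r, ?_, ?_⟩
  · rw [← cylSet_congr hag]; exact h2 r
  · rw [← piMap_congr hag]; exact hp r hr

lemma thinOn_ev {nrm : Finset ℕ → ℕ} {k : ℕ} {I : Finset ℕ} {X : Set TT}
    (h : IsThinOn (nu nrm k) I X) :
    ∀ᶠ p in (UU : Filter ℕ), IsThinOn (nuP nrm k p) I X := by
  unfold IsThinOn
  rw [Filter.eventually_all_finset]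
  intro m hm
  rw [Filter.eventually_all_finset]
  intro n hn
  by_cases hmn : m < n
  · filter_upwards [thin_ev (h m hm n hn hmn)] with p hp _
    exact hp
  · exact Eventually.of_forall fun p h' => absurd h' hmn

lemma nu_thin {nrm : Finset ℕ → ℕ} {k : ℕ} {I : Finset ℕ} {X : Set TT}
    (h : IsThinOn (nu nrm (k + 1)) I X) : nu nrm k X ≤ WW k (nrm I) := by
  refine nu_le_of ?_
  filter_upwards [thinOn_ev h, (eventually_gt_atTop k).filter_mono UU_atTop] with p hp hk
  have := phi_le_of_cover (E := CC nrm (p - k) k) (X := X) (ι := ℕ) {0} (fun _ => X)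
    (fun _ => WW k (nrm I)) (fun _ _ => (mem_CC k p).2 ⟨k, le_rfl, hk, I, hp, le_rfl⟩)
    (fun x hx => ⟨0, by simp, hx⟩)
  simpa [nuP] using this

lemma memB_of_clopen {X : Set TT} (h : IsClopen X) : ∃ n, memB n X := by
  classical
  have hloc : ∀ x : TT, ∃ n, ∀ y ∈ cylSet n x, (y ∈ X ↔ x ∈ X) := by
    have hop : ∀ Y : Set TT, IsOpen Y → ∀ x ∈ Y, ∃ n, ∀ y ∈ cylSet n x, y ∈ Y := by
      intro Y hY x hx
      obtain ⟨I, u, h1, h2⟩ := isOpen_pi_iff.1 hY x hx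
      refine ⟨I.sup id + 1, fun y hy => h2 fun a ha => ?_⟩
      have : a ≤ I.sup id := Finset.le_sup (f := id) ha
      rw [hy a (by omega)]
      exact (h1 a ha).2
    intro x
    by_cases hx : x ∈ X
    · obtain ⟨n, hn⟩ := hop X h.isOpen x hx
      exact ⟨n, fun y hy => by simp [hx, hn y hy]⟩
    · obtain ⟨n, hn⟩ := hop Xᶜ h.compl.isOpen x hx
      exact ⟨n, fun y hy => by have := hn y hy; simp only [Set.mem_compl_iff] at this; simp [hx, this]⟩
  choose n hn using hloc
  have hopen : ∀ x : TT, IsOpen (cylSet (n x) x) := by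
    intro x
    have : cylSet (n x) x = ⋂ i ∈ Finset.range (n x), {y | y i = x i} := by
      ext y; simp [cylSet]
    rw [this]
    refine isOpen_biInter_finset fun i _ => ?_
    exact (isOpen_discrete ({x i} : Set (Fin (2 ^ i)))).preimage
      (continuous_apply (A := fun n : ℕ => Fin (2 ^ n)) i)
  obtain ⟨t, ht⟩ := isCompact_univ.elim_finite_subcover (fun x => cylSet (n x) x) hopen
    (fun x _ => Set.mem_iUnion.2 ⟨x, fun i _ => rfl⟩)
  refine ⟨t.sup n, fun y z hyz => ?_⟩
  have hy := ht (Set.mem_univ y)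
  simp only [Set.mem_iUnion] at hy
  obtain ⟨x, hx, hyx⟩ := hy
  have hzx : z ∈ cylSet (n x) x := fun i hi => by
    rw [← hyx i hi, hyz i (hi.trans_le (Finset.le_sup (f := n) hx))]
  rw [hn x y hyx, hn x z hzx]

lemma nu_exhaustive {nrm : Finset ℕ → ℕ} (hn : NormP nrm)
    (unb : ∀ g : ℕ → ℕ, StrictMono g → ∀ N, ∃ t, N ≤ nrm ((Finset.range t).image g)) :
    Exhaustive (nu nrm 0) := by
  classical
  intro E hEc hd
  have hE := fun i => memB_of_clopen (hEc i)
  rw [ENNReal.tendsto_nhds_zero]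
  intro δ hδ
  have hδ2 : δ / 2 ≠ 0 := (ENNReal.half_pos hδ.ne').ne'
  obtain ⟨k, hk⟩ : ∃ k : ℕ, (2⁻¹ : ℝ≥0∞) ^ k < δ / 2 := ENNReal.exists_inv_two_pow_lt hδ2
  obtain ⟨M, hM⟩ := WW_small k
  obtain ⟨ε, hε, hεs⟩ := ENNReal.exists_pos_sum_of_countable' hδ2 ℕ
  choose ns hns i0 hi0 using fun j m => step_lemma hn E hE hd (k + 1) m (hε j).ne'
  let g : ℕ → ℕ := fun l => Nat.rec 0 (fun j q => ns j q) l
  have hgs : ∀ l, g (l + 1) = ns l (g l) := fun l => rfl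
  have hg : StrictMono g := strictMono_nat_of_lt_succ fun l => by rw [hgs]; exact hns _ _
  obtain ⟨t, ht⟩ := unb g hg M
  refine eventually_atTop.2 ⟨(Finset.range t).sup fun j => i0 j (g j), fun i hi => ?_⟩
  have hZ : ∀ j, ∃ Z, j ∈ Finset.range t →
      nu nrm (k + 1) Z ≤ ε j ∧ IsThin (nu nrm (k + 1)) (g j) (g (j + 1)) (E i \ Z) := by
    intro j
    by_cases hj : j ∈ Finset.range t
    · obtain ⟨Z, h⟩ := hi0 j (g j) i ((Finset.le_sup (f := fun j => i0 j (g j)) hj).trans hi)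
      exact ⟨Z, fun _ => h⟩
    · exact ⟨∅, fun h => absurd h hj⟩
  choose Z hZ using hZ
  set ZZ := ⋃ j ∈ Finset.range t, Z j with hZZ
  have h1 : nu nrm k ZZ ≤ δ / 2 := by
    refine (nu_level (Nat.le_succ k) _).trans ((nu_biUnion _ _).trans ?_)
    refine (Finset.sum_le_sum fun j hj => (hZ j hj).1).trans ?_
    exact (ENNReal.sum_le_tsum _).trans hεs.le
  have h2 : IsThinOn (nu nrm (k + 1)) ((Finset.range t).image g) (E i \ ZZ) := by
    intro m hm n hn' hmn
    obtain ⟨a, ha, rfl⟩ := Finset.mem_image.1 hm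
    obtain ⟨b, hb, rfl⟩ := Finset.mem_image.1 hn'
    have hab : a < b := hg.lt_iff_lt.1 hmn
    refine (hZ a ha).2.mono (hg.monotone hab) ?_
    intro z hz
    refine ⟨hz.1, fun h => hz.2 ?_⟩
    simp only [hZZ, Set.mem_iUnion]
    exact ⟨a, ha, h⟩
  have h3 : nu nrm k (E i \ ZZ) ≤ δ / 2 := (nu_thin h2).trans ((hM _ ht).trans hk.le)
  calc nu nrm 0 (E i) ≤ nu nrm k (E i) := nu_level (Nat.zero_le k) _
    _ ≤ nu nrm k ((E i \ ZZ) ∪ ZZ) := nu_mono (by rw [Set.sdiff_union_self]; exact Set.subset_union_left)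
    _ ≤ δ / 2 + δ / 2 := (nu_union _ _ _ _).trans (add_le_add h3 h1)
    _ = δ := ENNReal.add_halves δ

def KK (f : ℕ → Ordinal.{0}) (J : Finset ℕ) : Prop :=
  ∃ σ : ℕ → ℕ, ∀ j ∈ J, j ≤ σ j ∧ ∀ j' ∈ J, j < j' → σ j < j' ∧ f (σ j') < f (σ j)

lemma KK.mono {f : ℕ → Ordinal.{0}} {J J' : Finset ℕ} (h : KK f J) (hJ : J' ⊆ J) : KK f J' := by
  obtain ⟨σ, h⟩ := h
  exact ⟨σ, fun j hj => ⟨(h j (hJ hj)).1, fun j' hj' => (h j (hJ hj)).2 j' (hJ hj')⟩⟩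

def Col (f : ℕ → Ordinal.{0}) (I : Finset ℕ) (N : ℕ) : Prop :=
  ∃ c : ℕ → ℕ, (∀ i ∈ I, c i < N) ∧ ∀ a, KK f (I.filter fun i => c i = a)

noncomputable def nrmf (f : ℕ → Ordinal.{0}) (I : Finset ℕ) : ℕ := sInf {N | Col f I N}

lemma Col_union {f : ℕ → Ordinal.{0}} {I J : Finset ℕ} {M N : ℕ} (hI : Col f I M)
    (hJ : Col f J N) : Col f (I ∪ J) (M + N) := by
  classical
  obtain ⟨c, hc1, hc2⟩ := hI
  obtain ⟨d, hd1, hd2⟩ := hJ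
  refine ⟨fun i => if i ∈ I then c i else M + d i, fun i hi => ?_, fun a => ?_⟩
  · by_cases h : i ∈ I
    · simp only [h, if_true]
      have := hc1 i h
      omega
    · simp only [h, if_false]
      have := hd1 i ((Finset.mem_union.1 hi).resolve_left h)
      omega
  · by_cases ha : a < M
    · refine (hc2 a).mono fun i hi => ?_
      obtain ⟨h1, h2⟩ := Finset.mem_filter.1 hi
      by_cases h : i ∈ I
      · simp only [h, if_true] at h2
        exact Finset.mem_filter.2 ⟨h, h2⟩
      · simp only [h, if_false] at h2
        omega
    · refine (hd2 (a - M)).mono fun i hi => ?_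
      obtain ⟨h1, h2⟩ := Finset.mem_filter.1 hi
      by_cases h : i ∈ I
      · simp only [h, if_true] at h2
        have := hc1 i h
        omega
      · simp only [h, if_false] at h2
        exact Finset.mem_filter.2 ⟨(Finset.mem_union.1 h1).resolve_left h, by omega⟩

lemma Col_mono {f : ℕ → Ordinal.{0}} {I J : Finset ℕ} {N : ℕ} (hJ : Col f J N) (h : I ⊆ J) :
    Col f I N := by
  obtain ⟨c, h1, h2⟩ := hJ
  exact ⟨c, fun i hi => h1 i (h hi), fun a => (h2 a).mono (Finset.filter_subset_filter _ h)⟩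

lemma Col_KK {f : ℕ → Ordinal.{0}} {I : Finset ℕ} (h : KK f I) : Col f I 1 :=
  ⟨fun _ => 0, fun _ _ => Nat.one_pos, fun _ => h.mono (Finset.filter_subset _ _)⟩

lemma Col_card (f : ℕ → Ordinal.{0}) (I : Finset ℕ) : Col f I I.card := by
  classical
  induction I using Finset.induction_on with
  | empty => exact ⟨fun _ => 0, by simp, fun a => ⟨id, by simp⟩⟩
  | insert a s ha ih =>
    rw [Finset.card_insert_of_notMem ha, Finset.insert_eq, add_comm]
    refine Col_union (Col_KK ⟨id, fun j hj => ⟨le_rfl, fun j' hj' hlt => ?_⟩⟩) ih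
    rw [Finset.mem_singleton] at hj hj'
    omega

lemma Col_nrmf (f : ℕ → Ordinal.{0}) (I : Finset ℕ) : Col f I (nrmf f I) :=
  Nat.sInf_mem (s := {N | Col f I N}) ⟨_, Col_card f I⟩

lemma nrmf_le {f : ℕ → Ordinal.{0}} {I : Finset ℕ} {N : ℕ} (h : Col f I N) : nrmf f I ≤ N :=
  Nat.sInf_le h

lemma nrmf_NormP (f : ℕ → Ordinal.{0}) : NormP (nrmf f) where
  mono I J h := nrmf_le (Col_mono (Col_nrmf f J) h)
  add I J := nrmf_le (Col_union (Col_nrmf f I) (Col_nrmf f J))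
  card I := nrmf_le (Col_card f I)

lemma nrmf_small {f : ℕ → Ordinal.{0}} {S : Finset ℕ}
    (h : ∀ i ∈ S, ∀ j ∈ S, i < j → f j < f i) : SmallFor (nrmf f) S := by
  intro I hI
  have hI' : ∀ i, ∃ u, i ∈ I → u ∈ S ∧ i ≤ u ∧ ∀ i' ∈ I, i < i' → u < i' := by
    intro i
    by_cases hi : i ∈ I
    · obtain ⟨u, hu⟩ := hI i hi
      exact ⟨u, fun _ => hu⟩
    · exact ⟨0, fun h => absurd h hi⟩
  choose σ hσ using hI'
  refine nrmf_le (Col_KK ⟨σ, fun j hj => ⟨(hσ j hj).2.1, fun j' hj' hlt => ?_⟩⟩)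
  have h1 := (hσ j hj).2.2 j' hj' hlt
  exact ⟨h1, h _ (hσ j hj).1 _ (hσ j' hj').1 (h1.trans_le (hσ j' hj').2.1)⟩

lemma nrmf_unb (f : ℕ → Ordinal.{0}) (g : ℕ → ℕ) (hg : StrictMono g) (N : ℕ) :
    ∃ t, N ≤ nrmf f ((Finset.range t).image g) := by
  classical
  by_contra hcon
  push Not at hcon
  choose c hc1 hc2 using fun t => Col_nrmf f ((Finset.range t).image g)
  choose σ hσ using hc2
  have hmemI : ∀ j t, j < t → g j ∈ (Finset.range t).image g := fun j t h =>
    Finset.mem_image_of_mem g (Finset.mem_range.2 h)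
  have hC : ∀ j, ∃ C ∈ Set.Iic N, ∀ᶠ t in (UU : Filter ℕ), min (c t (g j)) N = C := fun j =>
    Ufin UU _ (Set.finite_Iic N) _ (fun t => Set.mem_Iic.2 (min_le_right _ _))
  choose C hCN hC using hC
  have hC' : ∀ j, ∀ᶠ t in (UU : Filter ℕ), j < t ∧ c t (g j) = C j := by
    intro j
    filter_upwards [hC j, (eventually_gt_atTop j).filter_mono UU_atTop] with t h1 h2
    refine ⟨h2, ?_⟩
    have := hc1 t (g j) (hmemI j t h2)
    have := hcon t
    omega
  obtain ⟨a, -, ha⟩ := Ufin UU _ (Set.finite_Iic N) C hCN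
  have hfreq : ∃ᶠ j in atTop, C j = a := (ha.frequently).filter_mono UU_atTop
  obtain ⟨h, hh, hha⟩ := extraction_of_frequently_atTop hfreq
  let e : ℕ → ℕ := fun s => g (h s)
  have he : StrictMono e := hg.comp hh
  have hcl : ∀ s, ∀ᶠ t in (UU : Filter ℕ),
      e s ∈ ((Finset.range t).image g).filter fun i => c t i = a := by
    intro s
    filter_upwards [hC' (h s)] with t ht
    exact Finset.mem_filter.2 ⟨hmemI _ _ ht.1, ht.2.trans (hha s)⟩
  have hτ : ∀ s, ∃ τ ∈ Set.Iic (e (s + 1)), ∀ᶠ t in (UU : Filter ℕ),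
      min (σ t a (e s)) (e (s + 1)) = τ := fun s =>
    Ufin UU _ (Set.finite_Iic _) _ (fun t => Set.mem_Iic.2 (min_le_right _ _))
  choose τ hτ1 hτ using hτ
  have hτ' : ∀ s, ∀ᶠ t in (UU : Filter ℕ), σ t a (e s) = τ s := by
    intro s
    filter_upwards [hτ s, hcl s, hcl (s + 1)] with t h1 h2 h3
    have := ((hσ t a _ h2).2 _ h3 (he (Nat.lt_succ_self s))).1
    omega
  have hdec : ∀ s, f (τ (s + 1)) < f (τ s) := by
    intro s
    obtain ⟨t, h1, h2, h3, h4⟩ := ((hτ' s).and ((hτ' (s + 1)).and ((hcl s).and (hcl (s + 1))))).exists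
    rw [← h1, ← h2]
    exact ((hσ t a _ h3).2 _ h4 (he (Nat.lt_succ_self s))).2
  exact not_strictAnti_of_wellFoundedLT (fun s => f (τ s)) (strictAnti_nat_of_succ_lt hdec)

lemma wf_DRel {ν : Set TT → ℝ≥0∞} (h : Exhaustive ν) {ε : ℝ} (hε : 0 < ε) :
    WellFounded (DRel ν ε) := by
  rw [wellFounded_iff_isEmpty_descending_chain]
  refine ⟨fun ⟨F, hF⟩ => ?_⟩
  have hmono : Monotone F := monotone_nat_of_le_succ fun n => (hF n).2.subset
  choose a ha1 ha2 using fun n => Set.exists_of_ssubset (hF n).2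
  have hlt : ∀ i j, i < j → Disjoint (a i) (a j) := by
    intro i j hij
    refine (hF j).1.2.2 (hmono (show i + 1 ≤ j + 1 by omega) (ha1 i)) (ha1 j) ?_
    intro he
    exact ha2 j (he ▸ hmono (show i + 1 ≤ j from hij) (ha1 i))
  have ht := h a (fun i => ((hF i).1.2.1 _ (ha1 i)).1) (fun i j hij => by
    rcases lt_or_gt_of_ne hij with h | h
    · exact hlt _ _ h
    · exact (hlt _ _ h).symm)
  have := ge_of_tendsto' ht fun i => ((hF i).1.2.1 _ (ha1 i)).2
  simp only [nonpos_iff_eq_zero, ENNReal.ofReal_eq_zero] at this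
  linarith

def DD (s : Finset ℕ) (n : ℕ) : Set TT := {z | z n ≠ 0 ∧ ∀ i ∈ s, i < n → z i = 0}

lemma DD_clopen (s : Finset ℕ) (n : ℕ) : IsClopen (DD s n) := by
  have hc : ∀ (i : ℕ) (A : Set (Fin (2 ^ i))), IsClopen {z : TT | z i ∈ A} := fun i A =>
    (isClopen_discrete A).preimage (continuous_apply (A := fun n : ℕ => Fin (2 ^ n)) i)
  have : DD s n = {z : TT | z n ∈ ({0}ᶜ : Set (Fin (2 ^ n)))} ∩
      ⋂ i ∈ s.filter (· < n), {z : TT | z i ∈ ({0} : Set (Fin (2 ^ i)))} := by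
    ext z
    simp [DD]
  rw [this]
  exact (hc _ _).inter (isClopen_biInter_finset fun i _ => hc _ _)

lemma DD_disj (s : Finset ℕ) {n n' : ℕ} (hn : n ∈ s) (h : n < n') : Disjoint (DD s n) (DD s n') :=
  Set.disjoint_left.2 fun _ h1 h2 => h1.1 (h2.2 n hn h)

lemma DD_big (f : ℕ → Ordinal.{0}) (s : Finset ℕ) (h : ∀ i ∈ s, ∀ j ∈ s, i < j → f j < f i)
    (n : ℕ) (hn : n ∈ s) (h1 : 1 ≤ n) : 16 ≤ nu (nrmf f) 0 (DD s n) := by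
  classical
  let S := s.filter (· ≤ n)
  let d : TT := fun i => if i = n then 1 else 0
  have hS : SmallFor (nrmf f) S := nrmf_small fun i hi j hj =>
    h i (Finset.mem_filter.1 hi).1 j (Finset.mem_filter.1 hj).1
  refine (le_nu_of fun p => main_estimate (nrmf_NormP f) 0 p S hS d).trans (nu_mono ?_)
  intro z hz
  refine ⟨?_, fun i hi hin => ?_⟩
  · rw [hz n (Finset.mem_filter.2 ⟨hn, le_rfl⟩)]
    simp only [d, if_true]
    have : 2 ≤ 2 ^ n := Nat.le_self_pow (by omega) 2
    intro he
    have := congrArg Fin.val he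
    rw [Fin.val_one', Fin.val_zero, Nat.mod_eq_of_lt (by omega)] at this
    omega
  · rw [hz i (Finset.mem_filter.2 ⟨hi, hin.le⟩)]
    simp [d, hin.ne]

def GG (s : Finset ℕ) : Set (Set TT) := {X | ∃ n ∈ s, X = DD s n}

lemma rank_ge (f : ℕ → Ordinal.{0}) (γ : Ordinal.{0})
    (hf : ∀ c < γ, ∀ N, ∃ n, N < n ∧ f n = c) (hwf : WellFounded (DRel (nu (nrmf f) 0) 1)) :
    ∀ b ≤ γ, ∀ s : Finset ℕ, (∀ i ∈ s, 1 ≤ i) → (∀ i ∈ s, ∀ j ∈ s, i < j → f j < f i) →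
      (∀ i ∈ s, b ≤ f i) → b ≤ (hwf.apply (GG s)).rank := by
  classical
  intro b
  induction b using WellFoundedLT.induction with
  | ind b ih =>
  intro hb s hs1 hs2 hs3
  refine le_of_forall_lt fun c hc => ?_
  obtain ⟨n', hn', hfc⟩ := hf c (hc.trans_le hb) (s.sup id)
  have hlt : ∀ i ∈ s, i < n' := fun i hi => (Finset.le_sup (f := id) hi).trans_lt hn'
  set s' := insert n' s with hs'
  have h1 : ∀ i ∈ s', 1 ≤ i := by
    intro i hi
    rcases Finset.mem_insert.1 hi with rfl | hi
    · omega
    · exact hs1 i hi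
  have h2 : ∀ i ∈ s', ∀ j ∈ s', i < j → f j < f i := by
    intro i hi j hj hij
    rcases Finset.mem_insert.1 hi with rfl | hi
    · rcases Finset.mem_insert.1 hj with rfl | hj
      · omega
      · have := hlt j hj
        omega
    · rcases Finset.mem_insert.1 hj with hj2 | hj2
      · rw [hj2, hfc]
        exact hc.trans_le (hs3 i hi)
      · exact hs2 i hi j hj2 hij
  have h3 : ∀ i ∈ s', c ≤ f i := by
    intro i hi
    rcases Finset.mem_insert.1 hi with rfl | hi
    · exact hfc.ge
    · exact hc.le.trans (hs3 i hi)
  have hr := ih c hc (hc.le.trans hb) s' h1 h2 h3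
  have hDD : ∀ n ∈ s, DD s' n = DD s n := by
    intro n hn
    ext z
    refine and_congr_right fun _ => ⟨fun h i hi => h i (Finset.mem_insert_of_mem hi), fun h i hi hin => ?_⟩
    rcases Finset.mem_insert.1 hi with rfl | hi
    · have := hlt n hn
      omega
    · exact h i hi hin
  have hrel : DRel (nu (nrmf f) 0) 1 (GG s') (GG s) := by
    refine ⟨⟨?_, ?_, ?_⟩, ?_⟩
    · refine (s'.finite_toSet.image (DD s')).subset ?_
      rintro _ ⟨n, hn, rfl⟩
      exact ⟨n, hn, rfl⟩
    · rintro _ ⟨n, hn, rfl⟩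
      refine ⟨DD_clopen _ _, ?_⟩
      refine le_trans ?_ (DD_big f s' h2 n hn (h1 n hn))
      rw [ENNReal.ofReal_one]
      norm_num
    · rintro _ ⟨n, hn, rfl⟩ _ ⟨m, hm, rfl⟩ hne
      rcases lt_trichotomy n m with h | h | h
      · exact DD_disj s' hn h
      · subst h; exact absurd rfl hne
      · exact (DD_disj s' hm h).symm
    · have hin : n' ∈ s' := Finset.mem_insert_self _ _
      refine ⟨?_, fun hsub => ?_⟩
      · rintro _ ⟨n, hn, rfl⟩
        exact ⟨n, Finset.mem_insert_of_mem hn, (hDD n hn).symm⟩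
      · obtain ⟨n, hn, he⟩ := hsub (show DD s' n' ∈ GG s' from ⟨n', hin, rfl⟩)
        have hd := DD_disj s' (Finset.mem_insert_of_mem hn : n ∈ s') (hlt n hn)
        rw [hDD n hn, he, disjoint_self] at hd
        have hbig := DD_big f s' h2 n' hin (h1 n' hin)
        rw [he, hd, Set.bot_eq_empty, nu_empty] at hbig
        norm_num at hbig
  exact hr.trans_lt ((hwf.apply (GG s)).rank_lt_of_rel hrel)

lemma exists_enum (γ : Ordinal.{0}) (hγ : γ < Ordinal.omega 1) :
    ∃ f : ℕ → Ordinal.{0}, ∀ c < γ, ∀ N, ∃ n, N < n ∧ f n = c := by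
  by_cases h0 : γ = 0
  · subst h0
    exact ⟨fun _ => 0, fun c hc => absurd hc (by simp)⟩
  have hcard : γ.card < Cardinal.aleph 1 := by
    rw [← Cardinal.lt_ord, Cardinal.ord_aleph]
    exact hγ
  have hcount : (Set.Iio γ).Countable := by
    rw [← Cardinal.le_aleph0_iff_set_countable, Cardinal.mk_Iio_ordinal,
      Cardinal.lift_le_aleph0]
    rw [← Cardinal.succ_aleph0, Order.lt_succ_iff] at hcard
    exact hcard
  obtain ⟨g, hg⟩ := hcount.exists_eq_range ⟨0, pos_iff_ne_zero.2 h0⟩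
  refine ⟨fun n => g n.unpair.1, fun c hc N => ?_⟩
  have : c ∈ Set.range g := hg ▸ hc
  obtain ⟨a, ha⟩ := this
  refine ⟨Nat.pair a (N + 1), (Nat.lt_succ_self N).trans_le (Nat.right_le_pair _ _), ?_⟩
  simp [ha]

/-- Main theorem: for every countable ordinal `γ` there is an exhaustive submeasure on
the algebra `ℬ` of clopen subsets of `T = ∏ₙ 2ⁿ` of exhaustivity rank at least `γ`. -/
theorem exists_exhaustive_submeasure_rank_ge (γ : Ordinal) (hγ : γ < Ordinal.omega 1) :
    ∃ ν : Set TT → ℝ≥0∞, IsSubmeasureOn ν ∧ Exhaustive ν ∧ γ ≤ rkSub ν := by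
  obtain ⟨f, hf⟩ := exists_enum γ hγ
  have hex : Exhaustive (nu (nrmf f) 0) := nu_exhaustive (nrmf_NormP f) (nrmf_unb f)
  refine ⟨nu (nrmf f) 0, ⟨nu_empty _ _, fun X Y _ _ h => nu_mono h,
    fun X Y _ _ => nu_union _ _ X Y⟩, hex, ?_⟩
  have hwf := wf_DRel hex (ε := 1) one_pos
  have h1 := rank_ge f γ hf hwf γ le_rfl ∅ (by simp) (by simp) (by simp)
  have hG : GG ∅ = ∅ := by
    ext X
    simp [GG]
  rw [hG] at h1
  have h2 : γ ≤ rkEps (nu (nrmf f) 0) 1 := by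
    unfold rkEps
    rw [dif_pos hwf]
    exact h1
  exact h2.trans (Ordinal.le_iSup (fun ε : {x : ℝ // 0 < x} => rkEps (nu (nrmf f) 0) ε.1) ⟨1, one_pos⟩)
end
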